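/- arXiv:0807.2137 — 3 statements merged into one kernel-verified Lean document; each statement's English description precedes it below -/
import Mathlib

section
/- For every 2-dimensional polyhedron P in ℝ² there exist two polynomials p₀, p₁ ∈ ℝ[x₁,x₂] such that P = {x ∈ ℝ² : p₀(x) ≥ 0 and p₁(x) ≥ 0}. -/
open scoped RealInnerProductSpace Pointwise
open Metric Set

noncomputable section

/-- Euclidean space ℝ^d. -/
abbrev E (d : ℕ) : Type := EuclideanSpace ℝ (Fin d)

/-- Evaluation of a multivariate polynomial at a point of ℝ^d. -/
def evalPoly {d : ℕ} (p : MvPolynomial (Fin d) ℝ) (x : E d) : ℝ :=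
  MvPolynomial.eval (fun i => x i) p

/-- A polytope: the convex hull of a (nonempty) finite point set. -/
def IsPolytope {d : ℕ} (P : Set (E d)) : Prop :=
  ∃ V : Finset (E d), V.Nonempty ∧ P = convexHull ℝ (V : Set (E d))

/-- A polyhedron: a nonempty intersection of finitely many closed halfspaces. -/
def IsPolyhedron {d : ℕ} (P : Set (E d)) : Prop :=
  P.Nonempty ∧ ∃ (m : ℕ) (a : Fin m → E d) (b : Fin m → ℝ),
    P = {x : E d | ∀ i, ⟪a i, x⟫ ≤ b i}

/-- Dimension of a set: the dimension of its affine hull. -/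
def dimS {d : ℕ} (A : Set (E d)) : ℕ :=
  Module.finrank ℝ (affineSpan ℝ A).direction

/-- Faces of a polytope (= exposed subsets). -/
def IsFaceOf {d : ℕ} (P F : Set (E d)) : Prop := IsExposed ℝ P F

/-- A facet of an n-dimensional polytope: an (n−1)-dimensional face. -/
def IsFacetOf {d : ℕ} (P F : Set (E d)) : Prop :=
  IsExposed ℝ P F ∧ dimS F + 1 = dimS P

/-- A vertex: a 0-dimensional face. -/
def IsVertexOf {d : ℕ} (P : Set (E d)) (v : E d) : Prop := IsExposed ℝ P {v}

/-- Support function h(P,u). -/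
def suppF {d : ℕ} (P : Set (E d)) (u : E d) : ℝ := sSup ((fun x => ⟪u, x⟫) '' P)

/-- Exposed face F(P,u) of P in direction u. -/
def exposedSet {d : ℕ} (P : Set (E d)) (u : E d) : Set (E d) :=
  {x ∈ P | ⟪u, x⟫ = suppF P u}

/-- The unit outer normal u_F(P) of a facet G of P, parallel to aff P. -/
def outerNormal {d : ℕ} (P G : Set (E d)) : E d :=
  Classical.epsilon fun u : E d =>
    u ∈ (affineSpan ℝ P).direction ∧ ‖u‖ = 1 ∧ exposedSet P u = G

/-- q_G(P,x) := (h(P,u_G(P)) − ⟨u_G(P),x⟩)/diam(P). -/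
def qF {d : ℕ} (P G : Set (E d)) (x : E d) : ℝ :=
  (suppF P (outerNormal P G) - ⟪outerNormal P G, x⟫) / Metric.diam P

/-- Conical hull: all nonnegative combinations of points of A. -/
def coneHull {d : ℕ} (A : Set (E d)) : Set (E d) :=
  {x | ∃ (n : ℕ) (c : Fin n → ℝ) (p : Fin n → E d),
    (∀ i, 0 ≤ c i) ∧ (∀ i, p i ∈ A) ∧ x = ∑ i, c i • p i}

/-- Supporting cone S(P,v) := cone (P − v). -/
def suppCone {d : ℕ} (P : Set (E d)) (v : E d) : Set (E d) :=
  coneHull ((fun x => x - v) '' P)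

/-- F⁻(P,x): the facets of P visible from x. -/
def visFacets {d : ℕ} (P : Set (E d)) (x : E d) : Set (Set (E d)) :=
  {G | IsFacetOf P G ∧ qF P G x ≤ 0}

/-- The facets of P containing the set A. -/
def facetsCont {d : ℕ} (P A : Set (E d)) : Set (Set (E d)) :=
  {G | IsFacetOf P G ∧ A ⊆ G}

/-- u_G(P): the normalized sum of the outer facet normals over facets containing G. -/
def uface {d : ℕ} (P G : Set (E d)) : E d :=
  ‖∑ᶠ F ∈ facetsCont P G, outerNormal P F‖⁻¹ • ∑ᶠ F ∈ facetsCont P G, outerNormal P F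

/-- The hyperplane H_v(P) := {x : ⟨x, u_v(P)⟩ = −1}. -/
def Hv {d : ℕ} (P : Set (E d)) (v : E d) : Set (E d) :=
  {x : E d | ⟪x, uface P {v}⟫ = -1}

/-- P_v := S(P,v) ∩ H_v(P). -/
def vertFig {d : ℕ} (P : Set (E d)) (v : E d) : Set (E d) :=
  suppCone P v ∩ Hv P v

/-- S_ρ(P,v) := cone((P_v + B(o,ρ)) ∩ H_v(P)). -/
def Srho {d : ℕ} (P : Set (E d)) (v : E d) (ρ : ℝ) : Set (E d) :=
  coneHull ((vertFig P v + Metric.closedBall (0 : E d) ρ) ∩ Hv P v)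

/-- Condition 𝒜(P): Hausdorff distance between P and {x ∈ aff P : g_l(x) ≥ 0} tends to 0. -/
def condA {d : ℕ} (P : Set (E d)) (g : ℕ → MvPolynomial (Fin d) ℝ) : Prop :=
  Filter.Tendsto
    (fun l => Metric.hausdorffDist P
      {x ∈ (affineSpan ℝ P : Set (E d)) | 0 ≤ evalPoly (g l) x})
    Filter.atTop (nhds 0)

/-- Condition ℐ(P): each g_l vanishes on all vertices of P. -/
def condI {d : ℕ} (P : Set (E d)) (g : ℕ → MvPolynomial (Fin d) ℝ) : Prop :=
  ∀ (l : ℕ) (v : E d), IsVertexOf P v → evalPoly (g l) v = 0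

/-- Condition 𝒞(P): each g_l is strictly concave on aff P. -/
def condC {d : ℕ} (P : Set (E d)) (g : ℕ → MvPolynomial (Fin d) ℝ) : Prop :=
  ∀ l : ℕ, StrictConcaveOn ℝ (affineSpan ℝ P : Set (E d)) (evalPoly (g l))

lemma exists_nonneg_sol {V : Type*} [Fintype V] [DecidableEq V] (A : Matrix V V ℝ) (b : V → ℝ)
    (hd : ∀ v, A v v = 1) (hoff : ∀ w, ∑ v ∈ Finset.univ.erase w, |A w v| ≤ 1 / 8)
    (hb : ∀ w, 1 / 2 ≤ b w ∧ b w ≤ 1) :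
    ∃ l : V → ℝ, (∀ v, 0 ≤ l v) ∧ ∀ w, ∑ v, A w v * l v = b w := by
  have hdet : A.det ≠ 0 := by
    apply det_ne_zero_of_sum_row_lt_diag
    intro w
    have := hoff w
    simp only [Real.norm_eq_abs, hd, abs_one]
    linarith
  have hu : IsUnit A.det := isUnit_iff_ne_zero.mpr hdet
  set l := A⁻¹.mulVec b with hl
  have hAl : A.mulVec l = b := by
    rw [hl, Matrix.mulVec_mulVec, Matrix.mul_nonsing_inv _ hu, Matrix.one_mulVec]
  have hsum : ∀ w, ∑ v, A w v * l v = b w := fun w => by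
    have := congrFun hAl w
    simpa [Matrix.mulVec, dotProduct] using this
  refine ⟨l, ?_, hsum⟩
  intro v0
  obtain ⟨m, -, hm⟩ := Finset.exists_max_image Finset.univ (fun v => |l v|) ⟨v0, Finset.mem_univ _⟩
  have key : ∀ w, |l w - b w| ≤ 1 / 8 * |l m| := by
    intro w
    have h1 := hsum w
    rw [← Finset.add_sum_erase _ _ (Finset.mem_univ w), hd, one_mul] at h1
    have h2 : l w - b w = - ∑ v ∈ Finset.univ.erase w, A w v * l v := by linarith
    rw [h2, abs_neg]
    calc _ ≤ ∑ v ∈ Finset.univ.erase w, |A w v * l v| := Finset.abs_sum_le_sum_abs _ _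
      _ ≤ ∑ v ∈ Finset.univ.erase w, |A w v| * |l m| := by
        apply Finset.sum_le_sum
        intro v _
        rw [abs_mul]
        exact mul_le_mul_of_nonneg_left (hm v (Finset.mem_univ _)) (abs_nonneg _)
      _ = (∑ v ∈ Finset.univ.erase w, |A w v|) * |l m| := by rw [Finset.sum_mul]
      _ ≤ _ := mul_le_mul_of_nonneg_right (hoff w) (abs_nonneg _)
  have hM : |l m| ≤ 8 / 7 := by
    have h1 := key m
    have h2 : |l m| ≤ |l m - b m| + |b m| := by
      have := abs_add_le (l m - b m) (b m)
      simpa using this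
    have h3 : |b m| ≤ 1 := by rw [abs_le]; constructor <;> linarith [hb m]
    linarith
  have := (abs_le.mp (key v0)).1
  linarith [(hb v0).1]

section Core

variable {W : Type*} [NormedAddCommGroup W] [NormedSpace ℝ W]

/-- cone of a finite family -/
def coneF (F : Finset (W →ₗ[ℝ] ℝ)) : Set W := {x | ∀ f ∈ F, 0 ≤ f x}

/-- sum functional -/
def tF (F : Finset (W →ₗ[ℝ] ℝ)) : W →ₗ[ℝ] ℝ := ∑ f ∈ F, f

lemma tF_apply (F : Finset (W →ₗ[ℝ] ℝ)) (x : W) : tF F x = ∑ f ∈ F, f x := by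
  simp [tF]

/-- slice -/
def QF (F : Finset (W →ₗ[ℝ] ℝ)) : Set W := {x | x ∈ coneF F ∧ tF F x = 1}

lemma perturb (F : Finset (W →ₗ[ℝ] ℝ)) (c d : W)
    (h : ∀ f ∈ F, 0 < f c ∨ (f c = 0 ∧ f d = 0)) :
    ∃ ε > (0 : ℝ), c + ε • d ∈ coneF F ∧ c - ε • d ∈ coneF F := by
  have : ∀ᶠ e in nhdsWithin (0 : ℝ) (Set.Ioi 0), ∀ f ∈ F, 0 ≤ f (c + e • d) ∧ 0 ≤ f (c - e • d) := by
    rw [Filter.eventually_all_finset]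
    intro f hf
    rcases h f hf with h | ⟨h1, h2⟩
    · apply Filter.Eventually.filter_mono nhdsWithin_le_nhds
      have c1 : ContinuousAt (fun e : ℝ => f c + e * f d) 0 := by fun_prop
      have c2 : ContinuousAt (fun e : ℝ => f c - e * f d) 0 := by fun_prop
      have e1 := c1.eventually (lt_mem_nhds (a := 0) (by simpa using h))
      have e2 := c2.eventually (lt_mem_nhds (a := 0) (by simpa using h))
      filter_upwards [e1, e2] with e h1 h2
      simp only [map_add, map_sub, map_smul, smul_eq_mul]
      exact ⟨h1.le, h2.le⟩
    · refine Filter.Eventually.of_forall fun e => ?_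
      simp [h1, h2]
  obtain ⟨e, he, he0⟩ := (this.and self_mem_nhdsWithin).exists
  exact ⟨e, he0, fun f hf => (he f hf).1, fun f hf => (he f hf).2⟩

lemma coneF_convex (F : Finset (W →ₗ[ℝ] ℝ)) : Convex ℝ (coneF F) := by
  intro x hx y hy a b ha hb _ f hf
  simp only [map_add, map_smul, smul_eq_mul]
  have := hx f hf
  have := hy f hf
  positivity

lemma QF_convex (F : Finset (W →ₗ[ℝ] ℝ)) : Convex ℝ (QF F) := by
  intro x hx y hy a b ha hb hab
  refine ⟨coneF_convex F hx.1 hy.1 ha hb hab, ?_⟩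
  simp only [map_add, map_smul, smul_eq_mul, hx.2, hy.2]
  linarith

lemma QF_le_one {F : Finset (W →ₗ[ℝ] ℝ)} {x : W} (hx : x ∈ QF F) {A : Finset (W →ₗ[ℝ] ℝ)}
    (hA : A ⊆ F) : tF A x ≤ 1 := by
  rw [← hx.2, tF_apply, tF_apply]
  exact Finset.sum_le_sum_of_subset_of_nonneg hA fun f hf _ => hx.1 f hf

lemma QF_le_one' {F : Finset (W →ₗ[ℝ] ℝ)} {x : W} (hx : x ∈ QF F) {f : W →ₗ[ℝ] ℝ}
    (hf : f ∈ F) : f x ≤ 1 := by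
  rw [← hx.2, tF_apply]
  exact Finset.single_le_sum (f := fun f : W →ₗ[ℝ] ℝ => f x) (fun f hf => hx.1 f hf) hf

variable [FiniteDimensional ℝ W]

lemma coneF_closed (F : Finset (W →ₗ[ℝ] ℝ)) : IsClosed (coneF F) := by
  have : coneF F = ⋂ f ∈ F, {x | 0 ≤ f x} := by ext; simp [coneF]
  rw [this]
  exact isClosed_biInter fun f _ =>
    isClosed_le continuous_const (LinearMap.continuous_of_finiteDimensional f)

lemma QF_closed (F : Finset (W →ₗ[ℝ] ℝ)) : IsClosed (QF F) :=
  (coneF_closed F).inter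
    (isClosed_eq (LinearMap.continuous_of_finiteDimensional (tF F)) continuous_const)

lemma QF_compact (F : Finset (W →ₗ[ℝ] ℝ)) (hF : ∀ x, (∀ f ∈ F, f x = 0) → x = 0) :
    IsCompact (QF F) := by
  let φ : W →ₗ[ℝ] (F → ℝ) := LinearMap.pi fun f => f.1
  have hφ : LinearMap.ker φ = ⊥ := by
    rw [LinearMap.ker_eq_bot']
    intro x hx
    exact hF x fun f hf => congrFun hx ⟨f, hf⟩
  have hc := LinearMap.isClosedEmbedding_of_injective hφ
  have hk : IsCompact (φ ⁻¹' (Set.Icc 0 1)) := hc.isCompact_preimage isCompact_Icc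
  refine hk.of_isClosed_subset (QF_closed F) ?_
  intro x hx
  exact ⟨fun f => hx.1 f.1 f.2, fun f => QF_le_one' hx f.2⟩

open Classical in
/-- active set -/
def act (F : Finset (W →ₗ[ℝ] ℝ)) (v : W) : Finset (W →ₗ[ℝ] ℝ) := F.filter fun f => f v = 0

lemma ext_unique {F : Finset (W →ₗ[ℝ] ℝ)} {v w : W} (hv : v ∈ (QF F).extremePoints ℝ)
    (hw : w ∈ QF F) (h : ∀ f ∈ F, f v = 0 → f w = 0) : w = v := by
  obtain ⟨ε, hε, h1, h2⟩ := perturb F v (w - v) (by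
    intro f hf
    rcases (hv.1.1 f hf).lt_or_eq with h0 | h0
    · exact Or.inl h0
    · right
      exact ⟨h0.symm, by rw [map_sub, h f hf h0.symm, ← h0, sub_zero]⟩)
  have t0 : tF F (w - v) = 0 := by rw [map_sub, hw.2, hv.1.2, sub_self]
  have := hv.2 (x₁ := v + ε • (w - v)) (x₂ := v - ε • (w - v))
    ⟨h1, by rw [map_add, map_smul, t0, hv.1.2]; simp⟩
    ⟨h2, by rw [map_sub, map_smul, t0, hv.1.2]; simp⟩
    ⟨1/2, 1/2, by norm_num, by norm_num, by norm_num, by module⟩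
  have h3 : ε • (w - v) = 0 := by simpa using this
  rcases smul_eq_zero.mp h3 with h4 | h4
  · exact absurd h4 hε.ne'
  · exact sub_eq_zero.mp h4

lemma ext_finite (F : Finset (W →ₗ[ℝ] ℝ)) : ((QF F).extremePoints ℝ).Finite := by
  classical
  apply Set.Finite.of_finite_image (f := act F)
  · exact (Finset.finite_toSet F.powerset).subset (by
      rintro _ ⟨v, _, rfl⟩
      exact Finset.mem_coe.mpr (Finset.mem_powerset.mpr (Finset.filter_subset _ _)))
  · intro v hv w hw hvw
    refine (ext_unique hv hw.1 ?_).symm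
    intro f hf h0
    have : f ∈ act F v := by simp [act, hf, h0]
    rw [hvw] at this
    simpa [act, hf] using this

/-- The convex function. -/
def GF (F : Finset (W →ₗ[ℝ] ℝ)) (V : Finset W) (L : W → (W →ₗ[ℝ] ℝ)) (l : W → ℝ) (ε : ℝ)
    (k : ℕ) (x : W) : ℝ :=
  ε * ∑ f ∈ F, f x ^ (2 * k) + ∑ v ∈ V, l v * (L v x) ^ (2 * k)

lemma exists_GF (F : Finset (W →ₗ[ℝ] ℝ)) :
    ∃ (V : Finset W) (L : W → (W →ₗ[ℝ] ℝ)) (l : W → ℝ) (ε : ℝ) (k : ℕ),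
      0 < ε ∧ 0 < k ∧ (∀ v, 0 ≤ l v) ∧ ∀ w ∈ (QF F).extremePoints ℝ, GF F V L l ε k w = 1 := by
  classical
  set V := (ext_finite F).toFinset with hV
  have hVm : ∀ v, v ∈ V ↔ v ∈ (QF F).extremePoints ℝ := by simp [hV]
  let L : W → (W →ₗ[ℝ] ℝ) := fun v => tF F - tF (act F v)
  have hLv : ∀ v ∈ V, L v v = 1 := by
    intro v hv
    have h1 := ((hVm v).1 hv).1.2
    have : tF (act F v) v = 0 := by
      rw [tF_apply]
      exact Finset.sum_eq_zero fun f hf => by simpa using (Finset.mem_filter.mp hf).2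
    simp [L, h1, this]
  have hL0 : ∀ v ∈ V, ∀ w ∈ V, 0 ≤ L v w := by
    intro v hv w hw
    have h1 := ((hVm w).1 hw).1
    have := QF_le_one h1 (Finset.filter_subset (fun f => f v = 0) F)
    simp only [L, LinearMap.sub_apply, h1.2]
    simp only [act]
    convert sub_nonneg.mpr this
  have hL1 : ∀ v ∈ V, ∀ w ∈ V, v ≠ w → L v w < 1 := by
    intro v hv w hw hne
    have h1 := ((hVm w).1 hw).1
    have hpos : 0 < tF (act F v) w := by
      by_contra hcon
      rw [tF_apply] at hcon
      have hnn : ∀ f ∈ act F v, 0 ≤ f w := fun f hf => h1.1 f (Finset.mem_filter.mp hf).1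
      have hz : ∑ f ∈ act F v, f w = 0 := le_antisymm (not_lt.mp hcon) (Finset.sum_nonneg hnn)
      rw [Finset.sum_eq_zero_iff_of_nonneg hnn] at hz
      exact hne (ext_unique ((hVm v).1 hv) h1
        (fun f hf h0 => hz f (by simp [act, hf, h0]))).symm
    simp only [L, LinearMap.sub_apply, h1.2]
    linarith
  set δ : ℝ := 1 / (8 * ((V.card : ℝ) + 1)) with hδ
  have hδ0 : 0 < δ := by positivity
  have hk : ∀ᶠ k : ℕ in Filter.atTop, ∀ v ∈ V, ∀ w ∈ V, v ≠ w → (L v w) ^ k ≤ δ := by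
    rw [Filter.eventually_all_finset]
    intro v hv
    rw [Filter.eventually_all_finset]
    intro w hw
    by_cases hne : v = w
    · exact Filter.Eventually.of_forall fun k h => absurd hne h
    · have := tendsto_pow_atTop_nhds_zero_of_lt_one (hL0 v hv w hw) (hL1 v hv w hw hne)
      filter_upwards [this.eventually (gt_mem_nhds hδ0)] with k hk _
      exact hk.le
  obtain ⟨k, hk, hk0⟩ := (hk.and (Filter.eventually_gt_atTop 0)).exists
  set ε : ℝ := 1 / (2 * ((F.card : ℝ) + 1)) with hε
  have hε0 : 0 < ε := by positivity
  have hb : ∀ w ∈ V, 0 ≤ ∑ f ∈ F, f w ^ (2 * k) ∧ ∑ f ∈ F, f w ^ (2 * k) ≤ F.card := by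
    intro w hw
    have h1 := ((hVm w).1 hw).1
    refine ⟨Finset.sum_nonneg fun f hf => pow_nonneg (h1.1 f hf) _, ?_⟩
    have := Finset.sum_le_card_nsmul F (fun f => f w ^ (2 * k)) 1
      (fun f hf => pow_le_one₀ (h1.1 f hf) (QF_le_one' h1 hf))
    simpa using this
  obtain ⟨l, hl0, hl⟩ := exists_nonneg_sol (V := V)
    (fun w v => (L v w) ^ (2 * k)) (fun w => 1 - ε * ∑ f ∈ F, f w.1 ^ (2 * k))
    (fun v => by simp [hLv v.1 v.2])
    (by
      intro w
      have : ∀ v ∈ Finset.univ.erase w, |(L v.1 w.1) ^ (2 * k)| ≤ δ := by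
        intro v hv
        have hne : v.1 ≠ w.1 := fun h => (Finset.mem_erase.mp hv).1 (Subtype.ext h)
        have h0 := hL0 v.1 v.2 w.1 w.2
        rw [abs_of_nonneg (pow_nonneg h0 _)]
        refine le_trans ?_ (hk v.1 v.2 w.1 w.2 hne)
        exact pow_le_pow_of_le_one h0 (hL1 v.1 v.2 w.1 w.2 hne).le (by omega)
      have h2 := Finset.sum_le_card_nsmul _ _ _ this
      refine h2.trans ?_
      have h3 : ((Finset.univ.erase w).card : ℝ) ≤ V.card := by
        have := Finset.card_le_card (Finset.erase_subset w Finset.univ)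
        rw [Finset.card_univ, Fintype.card_coe] at this
        exact_mod_cast this
      rw [nsmul_eq_mul]
      calc _ ≤ ((V.card : ℝ) + 1) * δ := by
            apply mul_le_mul_of_nonneg_right _ hδ0.le
            linarith
        _ = 1 / 8 := by rw [hδ]; field_simp)
    (by
      intro w
      have ⟨h1, h2⟩ := hb w.1 w.2
      have h3 : 0 ≤ ε * ∑ f ∈ F, f w.1 ^ (2 * k) := mul_nonneg hε0.le h1
      have h4 : ε * ∑ f ∈ F, f w.1 ^ (2 * k) ≤ ε * (F.card + 1) :=
        mul_le_mul_of_nonneg_left (by linarith) hε0.le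
      have h5 : ε * (F.card + 1) = 1 / 2 := by rw [hε]; field_simp
      constructor <;> linarith)
  refine ⟨V, L, fun v => if h : v ∈ V then l ⟨v, h⟩ else 0, ε, k, hε0, hk0, ?_, ?_⟩
  · intro v
    dsimp only
    split_ifs with h
    · exact hl0 _
    · exact le_rfl
  · intro w hw
    have := hl ⟨w, (hVm w).2 hw⟩
    dsimp only at this
    unfold GF
    rw [← Finset.sum_attach V, ← Finset.univ_eq_attach]
    have h2 : ∑ x : V, (if h : (x : W) ∈ V then l ⟨x, h⟩ else 0) * (L x w) ^ (2 * k)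
        = ∑ v : V, (L v w) ^ (2 * k) * l v := by
      refine Finset.sum_congr rfl fun x _ => ?_
      rw [dif_pos x.2, mul_comm]
    rw [h2, this]
    ring

lemma GF_strict (F : Finset (W →ₗ[ℝ] ℝ)) (V : Finset W) (L : W → (W →ₗ[ℝ] ℝ)) (l : W → ℝ) (ε : ℝ)
    (k : ℕ) (hF : ∀ x, (∀ f ∈ F, f x = 0) → x = 0) (hε : 0 < ε) (hk : 0 < k)
    (hl : ∀ v, 0 ≤ l v) : StrictConvexOn ℝ Set.univ (GF F V L l ε k) := by
  have hs := (even_two_mul k).strictConvexOn_pow (by omega)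
  refine ⟨convex_univ, ?_⟩
  intro x _ y _ hxy a b ha hb hab
  have hle : ∀ f : W →ₗ[ℝ] ℝ, f (a • x + b • y) ^ (2 * k) ≤ a * f x ^ (2 * k) + b * f y ^ (2 * k) := by
    intro f
    have := hs.convexOn.2 (Set.mem_univ (f x)) (Set.mem_univ (f y)) ha.le hb.le hab
    simpa using this
  have h1 : ∑ f ∈ F, f (a • x + b • y) ^ (2 * k)
      < ∑ f ∈ F, (a * f x ^ (2 * k) + b * f y ^ (2 * k)) := by
    apply Finset.sum_lt_sum (fun f _ => hle f)
    by_contra hcon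
    push Not at hcon
    apply hxy
    rw [← sub_eq_zero]
    apply hF
    intro f hf
    by_contra hne
    have hne' : f x ≠ f y := fun h => hne (by simp [h])
    have := hs.2 (Set.mem_univ (f x)) (Set.mem_univ (f y)) hne' ha hb hab
    have h2 := hcon f hf
    simp only [map_add, map_smul, smul_eq_mul] at this h2
    linarith
  have h2 : ∑ v ∈ V, l v * (L v (a • x + b • y)) ^ (2 * k)
      ≤ ∑ v ∈ V, l v * (a * L v x ^ (2 * k) + b * L v y ^ (2 * k)) :=
    Finset.sum_le_sum fun v _ => mul_le_mul_of_nonneg_left (hle _) (hl v)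
  have h3 := mul_lt_mul_of_pos_left h1 hε
  have e1 : ∑ f ∈ F, (a * f x ^ (2 * k) + b * f y ^ (2 * k))
      = a * ∑ f ∈ F, f x ^ (2 * k) + b * ∑ f ∈ F, f y ^ (2 * k) := by
    rw [Finset.sum_add_distrib, Finset.mul_sum, Finset.mul_sum]
  have e2 : ∑ v ∈ V, l v * (a * L v x ^ (2 * k) + b * L v y ^ (2 * k))
      = a * ∑ v ∈ V, l v * L v x ^ (2 * k) + b * ∑ v ∈ V, l v * L v y ^ (2 * k) := by
    rw [Finset.mul_sum, Finset.mul_sum, ← Finset.sum_add_distrib]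
    exact Finset.sum_congr rfl fun v _ => by ring
  rw [e1] at h3
  rw [e2] at h2
  simp only [GF, smul_eq_mul]
  nlinarith [h2, h3]

lemma GF_smul (F : Finset (W →ₗ[ℝ] ℝ)) (V : Finset W) (L : W → (W →ₗ[ℝ] ℝ)) (l : W → ℝ) (ε : ℝ)
    (k : ℕ) (c : ℝ) (x : W) : GF F V L l ε k (c • x) = c ^ (2 * k) * GF F V L l ε k x := by
  simp only [GF, map_smul, smul_eq_mul, mul_pow, mul_add, Finset.mul_sum]
  congr 1
  · exact Finset.sum_congr rfl fun v _ => by ring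
  · exact Finset.sum_congr rfl fun v _ => by ring

lemma facet (F : Finset (W →ₗ[ℝ] ℝ)) (hF : ∀ x, (∀ f ∈ F, f x = 0) → x = 0)
    (hW : Module.finrank ℝ W = 3) (y0 : W) (hy0 : ∀ f ∈ F, 0 < f y0)
    (hirr : ∀ f ∈ F, ∃ x, f x < 0 ∧ ∀ g ∈ F, g ≠ f → 0 ≤ g x) (f : W →ₗ[ℝ] ℝ) (hf : f ∈ F) :
    (∃ c ∈ QF F, f c = 0 ∧ ∀ g ∈ F, g ≠ f → 0 < g c) ∧
    ∃ v ∈ (QF F).extremePoints ℝ, ∃ w ∈ (QF F).extremePoints ℝ, v ≠ w ∧ f v = 0 ∧ f w = 0 := by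
  classical
  obtain ⟨d, hd, hd0⟩ : ∃ d : W, (f d = 0 ∧ tF F d = 0) ∧ d ≠ 0 := by
    have hker : LinearMap.ker (f.prod (tF F)) ≠ ⊥ := by
      apply LinearMap.ker_ne_bot_of_finrank_lt
      simp
      omega
    obtain ⟨d, hd, hd0⟩ := Submodule.exists_mem_ne_zero_of_ne_bot hker
    refine ⟨d, ?_, hd0⟩
    simpa using hd
  obtain ⟨g0, hg0, hg0f⟩ : ∃ g ∈ F, g ≠ f := by
    by_contra hcon
    push Not at hcon
    exact hd0 (hF d fun g hg => by rw [hcon g hg]; exact hd.1)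
  obtain ⟨x1, hx1, hx1'⟩ := hirr f hf
  obtain ⟨c, hcQ, hc, hcg⟩ : ∃ c ∈ QF F, f c = 0 ∧ ∀ g ∈ F, g ≠ f → 0 < g c := by
    set c0 := f y0 • x1 - f x1 • y0 with hc0
    have h1 : f c0 = 0 := by simp [hc0]; ring
    have h2 : ∀ g ∈ F, g ≠ f → 0 < g c0 := by
      intro g hg hgf
      simp only [hc0, map_sub, map_smul, smul_eq_mul]
      have := mul_nonneg (hy0 f hf).le (hx1' g hg hgf)
      have := mul_pos (neg_pos.mpr hx1) (hy0 g hg)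
      linarith
    have hnn : ∀ g ∈ F, 0 ≤ g c0 := by
      intro g hg
      by_cases h : g = f
      · rw [h, h1]
      · exact (h2 g hg h).le
    have ht : 0 < tF F c0 := by
      rw [tF_apply]
      exact Finset.sum_pos' hnn ⟨g0, hg0, h2 g0 hg0 hg0f⟩
    refine ⟨(tF F c0)⁻¹ • c0, ⟨?_, ?_⟩, ?_, ?_⟩
    · intro g hg
      rw [map_smul, smul_eq_mul]
      exact mul_nonneg (inv_nonneg.mpr ht.le) (hnn g hg)
    · rw [map_smul, smul_eq_mul, inv_mul_cancel₀ ht.ne']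
    · rw [map_smul, h1, smul_zero]
    · intro g hg hgf
      rw [map_smul, smul_eq_mul]
      exact mul_pos (inv_pos.mpr ht) (h2 g hg hgf)
  refine ⟨⟨c, hcQ, hc, hcg⟩, ?_⟩
  set S : Set W := QF F ∩ {x | f x = 0} with hS
  have hSc : IsCompact S := (QF_compact F hF).inter_right
    (isClosed_eq (LinearMap.continuous_of_finiteDimensional f) continuous_const)
  have hSconv : Convex ℝ S := by
    apply (QF_convex F).inter
    intro x hx y hy a b _ _ _
    simp only [Set.mem_ofPred_eq] at hx hy ⊢
    simp [hx, hy]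
  have hSe : IsExtreme ℝ (QF F) S := by
    refine ⟨Set.inter_subset_left, ?_⟩
    rintro x hx y hy z hz ⟨a, b, ha, hb, hab, rfl⟩
    refine ⟨hx, ?_⟩
    have h1 := hz.2
    simp only [Set.mem_ofPred_eq, map_add, map_smul, smul_eq_mul] at h1 ⊢
    have h2 := hx.1 f hf
    have h3 := mul_nonneg hb.le (hy.1 f hf)
    nlinarith [mul_nonneg ha.le h2]
  obtain ⟨v, hv⟩ := hSc.extremePoints_nonempty ⟨c, hcQ, hc⟩
  have : ∃ w ∈ S.extremePoints ℝ, v ≠ w := by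
    by_contra hcon
    push Not at hcon
    have hsub : S.extremePoints ℝ ⊆ {v} := fun w hw => (hcon w hw).symm
    have hKM := closure_convexHull_extremePoints hSc hSconv
    have hSv : S ⊆ {v} := by
      rw [← hKM]
      refine closure_minimal (convexHull_min hsub (convex_singleton v)) isClosed_singleton
    obtain ⟨e, he, h1, h2⟩ := perturb F c d (by
      intro g hg
      by_cases h : g = f
      · right; rw [h]; exact ⟨hc, hd.1⟩
      · left; exact hcg g hg h)
    have hc' : c ∈ S := ⟨hcQ, hc⟩
    have hcd : c + e • d ∈ S :=
      ⟨⟨h1, by rw [map_add, map_smul, hd.2, hcQ.2]; simp⟩, by simp [hc, hd.1]⟩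
    have e1 := hSv hc'
    have e2 := hSv hcd
    simp only [Set.mem_singleton_iff] at e1 e2
    have : e • d = 0 := by
      have := e2.trans e1.symm
      simpa using this
    rcases smul_eq_zero.mp this with h | h
    · exact he.ne' h
    · exact hd0 h
  obtain ⟨w, hw, hvw⟩ := this
  exact ⟨v, hSe.extremePoints_subset_extremePoints hv, w,
    hSe.extremePoints_subset_extremePoints hw, hvw, hv.1.2, hw.1.2⟩

/-- Core result for irredundant families. -/
lemma core_irr (F : Finset (W →ₗ[ℝ] ℝ)) (hF : ∀ x, (∀ f ∈ F, f x = 0) → x = 0)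
    (hW : Module.finrank ℝ W = 3) (y0 : W) (hy0 : ∀ f ∈ F, 0 < f y0)
    (hirr : ∀ f ∈ F, ∃ x, f x < 0 ∧ ∀ g ∈ F, g ≠ f → 0 ≤ g x) :
    ∃ (V : Finset W) (L : W → (W →ₗ[ℝ] ℝ)) (l : W → ℝ) (ε : ℝ) (k : ℕ),
      ∀ x, (x ∈ coneF F ∨ -x ∈ coneF F) ↔
        (0 ≤ tF F x ^ (2 * k) - GF F V L l ε k x ∧ 0 ≤ ∏ f ∈ F, (tF F x * f x)) := by
  classical
  obtain ⟨V, L, l, ε, k, hε, hk, hl, hG⟩ := exists_GF F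
  refine ⟨V, L, l, ε, k, ?_⟩
  have hfac := facet F hF hW y0 hy0 hirr
  set G := GF F V L l ε k with hGdef
  have hsc : StrictConvexOn ℝ Set.univ G := GF_strict F V L l ε k hF hε hk hl
  have hsm : ∀ (c : ℝ) x, G (c • x) = c ^ (2 * k) * G x := GF_smul F V L l ε k
  have hGcont : Continuous G := by
    have : ∀ f : W →ₗ[ℝ] ℝ, Continuous f := fun f => LinearMap.continuous_of_finiteDimensional f
    rw [hGdef]
    unfold GF
    refine Continuous.add (continuous_const.mul (continuous_finsetSum _ fun f _ => (this f).pow _))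
      (continuous_finsetSum _ fun v _ => continuous_const.mul ((this _).pow _))
  have hK : Convex ℝ {x | G x ≤ 1} := by
    have := hsc.convexOn.convex_le 1
    simpa using this
  have hQK : ∀ x ∈ QF F, G x ≤ 1 := by
    have h1 := closure_convexHull_extremePoints (QF_compact F hF) (QF_convex F)
    have : QF F ⊆ {x | G x ≤ 1} := by
      rw [← h1]
      refine closure_minimal (convexHull_min (fun w hw => (hG w hw).le) hK)
        (isClosed_le hGcont continuous_const)
    exact this
  have hG0 : ∀ x, x ≠ 0 → 0 < G x := by
    intro x hx
    have h1 := hsc.2 (Set.mem_univ x) (Set.mem_univ (-x)) (fun h => hx (by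
      have : (2 : ℝ) • x = 0 := by rw [two_smul]; nth_rewrite 2 [h]; simp
      simpa using this)) (by norm_num : (0:ℝ) < 1/2) (by norm_num : (0:ℝ) < 1/2) (by norm_num)
    have e1 : (1/2 : ℝ) • x + (1/2 : ℝ) • (-x) = (0:ℝ) • x := by module
    have e2 : G (-x) = G x := by
      have := hsm (-1) x
      simpa [pow_mul] using this
    have e3 : (0:ℝ)^(2*k) = 0 := zero_pow (by omega)
    rw [e1, hsm, e2, e3] at h1
    simp only [smul_eq_mul] at h1
    linarith
  -- points of the convex body on a facet line
  have hb : ∀ f ∈ F, ∀ x, tF F x = 1 → G x ≤ 1 → f x = 0 → x ∈ QF F := by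
    intro f hf x hx hGx hfx
    obtain ⟨⟨c, hcQ, hc, -⟩, v, hv, w, hw, hvw, hfv, hfw⟩ := hfac f hf
    have hfy := (hy0 f hf).ne'
    have hsurj : LinearMap.range (f.prod (tF F)) = ⊤ := by
      rw [LinearMap.range_eq_top]
      rintro ⟨a, b⟩
      refine ⟨(a / f y0) • y0 + (b - a / f y0 * tF F y0) • c, ?_⟩
      simp [hc, hcQ.2, hfy]
    have hfr : Module.finrank ℝ (LinearMap.ker (f.prod (tF F))) = 1 := by
      have := LinearMap.finrank_range_add_finrank_ker (f.prod (tF F))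
      rw [hsurj, hW, finrank_top] at this
      simp at this
      omega
    have hwv : w - v ∈ LinearMap.ker (f.prod (tF F)) := by
      simp [hfv, hfw, hw.1.2, hv.1.2]
    have hxv : x - v ∈ LinearMap.ker (f.prod (tF F)) := by
      simp [hfv, hfx, hx, hv.1.2]
    have hne : (⟨w - v, hwv⟩ : LinearMap.ker (f.prod (tF F))) ≠ 0 := by
      intro h
      have := congrArg Subtype.val h
      exact hvw (sub_eq_zero.mp this).symm
    obtain ⟨s, hs⟩ := (finrank_eq_one_iff_of_nonzero' _ hne).mp hfr ⟨x - v, hxv⟩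
    have hs' : s • (w - v) = x - v := congrArg Subtype.val hs
    have hxe : x = v + s • (w - v) := by rw [hs']; abel
    rcases lt_or_ge s 0 with h1 | h1
    · exfalso
      have hpos : 0 < 1 - s := by linarith
      have hxw : x ≠ w := by
        intro h
        rw [h] at hs'
        have : (s - 1) • (w - v) = 0 := by rw [sub_smul, hs', one_smul, sub_self]
        rcases smul_eq_zero.mp this with h | h
        · linarith
        · exact hvw (sub_eq_zero.mp h).symm
      have := hsc.2 (Set.mem_univ x) (Set.mem_univ w) hxw
        (show 0 < 1 / (1 - s) by positivity)
        (show 0 < -s / (1 - s) from div_pos (by linarith) hpos) (by field_simp; ring)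
      have e : (1 / (1 - s)) • x + (-s / (1 - s)) • w = v := by
        rw [hxe]
        match_scalars <;> field_simp <;> ring
      rw [e, hG v hv, hG w hw] at this
      simp only [smul_eq_mul] at this
      have h2 : 1 / (1 - s) * G x ≤ 1 / (1 - s) := by
        have : 0 < 1 / (1 - s) := by positivity
        nlinarith
      have h3 : 1 / (1 - s) + -s / (1 - s) * 1 = 1 := by field_simp; ring
      linarith
    rcases lt_or_ge 1 s with h2 | h2
    · exfalso
      have hpos : 0 < s := by linarith
      have hxw : x ≠ v := by
        intro h
        rw [h, sub_self] at hs'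
        rcases smul_eq_zero.mp hs' with h | h
        · linarith
        · exact hvw (sub_eq_zero.mp h).symm
      have := hsc.2 (Set.mem_univ x) (Set.mem_univ v) hxw
        (show 0 < 1 / s by positivity)
        (show 0 < (s - 1) / s from div_pos (by linarith) hpos) (by field_simp; ring)
      have e : (1 / s) • x + ((s - 1) / s) • v = w := by
        rw [hxe]
        match_scalars <;> field_simp <;> ring
      rw [e, hG v hv, hG w hw] at this
      simp only [smul_eq_mul] at this
      have h2 : 1 / s * G x ≤ 1 / s := by
        have : 0 < 1 / s := by positivity
        nlinarith
      have h3 : 1 / s + (s - 1) / s * 1 = 1 := by field_simp; ring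
      linarith
    · have := QF_convex F hv.1 hw.1 (a := 1 - s) (b := s) (by linarith) h1 (by ring)
      have e : (1 - s) • v + s • w = x := by rw [hxe]; module
      rwa [e] at this
  have hab : ∀ f ∈ F, ∀ g ∈ F, f ≠ g → ∀ x, tF F x = 1 → G x ≤ 1 → f x ≤ 0 → g x ≤ 0 →
      x ∈ QF F := by
    intro f hf g hg hfg x hx hGx hfx hgx
    rcases hgx.lt_or_eq with hgx | hgx
    · obtain ⟨c, hcQ, hc, hcg⟩ := (hfac f hf).1
      have hgc := hcg g hg (Ne.symm hfg)
      have hden : 0 < g c - g x := by linarith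
      set s := g c / (g c - g x) with hs
      have hs0 : 0 < s := div_pos hgc hden
      have hs1 : 0 < 1 - s := by
        rw [hs, one_sub_div hden.ne']
        exact div_pos (by linarith) hden
      set y := s • x + (1 - s) • c with hy
      have hyG : G y ≤ 1 := hK hGx (hQK c hcQ) hs0.le hs1.le (by ring)
      have hyt : tF F y = 1 := by simp [hy, hx, hcQ.2]
      have hgy : g y = 0 := by
        simp only [hy, map_add, map_smul, smul_eq_mul, hs]
        field_simp
        ring
      have hyQ := hb g hg y hyt hyG hgy
      have h1 := hyQ.1 f hf
      simp only [hy, map_add, map_smul, smul_eq_mul, hc, mul_zero, add_zero] at h1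
      have h2 : f x = 0 := le_antisymm hfx (by
        by_contra hcon
        push Not at hcon
        nlinarith)
      exact hb f hf x hx hGx h2
    · exact hb g hg x hx hGx hgx
  have main : ∀ x, tF F x = 1 → G x ≤ 1 → 0 ≤ ∏ f ∈ F, f x → x ∈ QF F := by
    intro x hx hGx hp
    by_contra hxQ
    have : ∃ f ∈ F, f x < 0 := by
      by_contra hcon
      push Not at hcon
      exact hxQ ⟨hcon, hx⟩
    obtain ⟨f, hf, hfx⟩ := this
    rw [← Finset.mul_prod_erase F (fun f => f x) hf] at hp
    have hpos : 0 < ∏ g ∈ F.erase f, g x := by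
      apply Finset.prod_pos
      intro g hg
      by_contra hcon
      push Not at hcon
      have := Finset.mem_erase.mp hg
      exact hxQ (hab f hf g this.2 (Ne.symm this.1) x hx hGx hfx.le hcon)
    nlinarith
  have tpos : ∀ x ∈ coneF F, x ≠ 0 → 0 < tF F x := by
    intro x hx h0
    rw [tF_apply]
    refine Finset.sum_pos' hx ?_
    by_contra hcon
    push Not at hcon
    exact h0 (hF x fun f hf => le_antisymm (hcon f hf) (hx f hf))
  have fwd : ∀ x ∈ coneF F, (0 ≤ tF F x ^ (2 * k) - G x ∧ 0 ≤ ∏ f ∈ F, (tF F x * f x)) := by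
    intro x hx
    have ht : 0 ≤ tF F x := by rw [tF_apply]; exact Finset.sum_nonneg hx
    refine ⟨?_, Finset.prod_nonneg fun f hf => mul_nonneg ht (hx f hf)⟩
    by_cases h0 : x = 0
    · have := hsm 0 x
      have e3 : (0:ℝ)^(2*k) = 0 := zero_pow (by omega)
      rw [e3, zero_smul, zero_mul] at this
      rw [h0, this, map_zero, e3, sub_zero]
    · have htp := tpos x hx h0
      have hQ : (tF F x)⁻¹ • x ∈ QF F := ⟨fun f hf => by
          rw [map_smul, smul_eq_mul]
          exact mul_nonneg (inv_nonneg.mpr htp.le) (hx f hf),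
        by rw [map_smul, smul_eq_mul, inv_mul_cancel₀ htp.ne']⟩
      have h1 := hQK _ hQ
      rw [hsm, inv_pow, inv_mul_le_iff₀ (by positivity)] at h1
      linarith
  intro x
  constructor
  · rintro (hx | hx)
    · exact fwd x hx
    · have h1 := fwd _ hx
      have e2 : G (-x) = G x := by
        have := hsm (-1) x
        simpa [pow_mul] using this
      rw [e2] at h1
      simpa [pow_mul] using h1
  · rintro ⟨h1, h2⟩
    by_cases h0 : x = 0
    · left
      intro f _
      simp [h0]
    have ht : tF F x ≠ 0 := by
      intro ht
      have := hG0 x h0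
      rw [ht, zero_pow (by omega)] at h1
      linarith
    have hQ : (tF F x)⁻¹ • x ∈ QF F := by
      apply main
      · rw [map_smul, smul_eq_mul, inv_mul_cancel₀ ht]
      · have : 0 < tF F x ^ (2 * k) := (even_two_mul k).pow_pos ht
        rw [hsm, inv_pow, inv_mul_le_iff₀ this]
        linarith
      · have : ∏ f ∈ F, f ((tF F x)⁻¹ • x)
            = ∏ f ∈ F, ((tF F x)⁻¹ ^ 2 * (tF F x * f x)) := by
          refine Finset.prod_congr rfl fun f _ => ?_
          rw [map_smul, smul_eq_mul]
          field_simp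
        rw [this, Finset.prod_mul_distrib]
        exact mul_nonneg (Finset.prod_nonneg fun _ _ => by positivity) h2
    rcases lt_or_gt_of_ne ht with htn | htp
    · right
      intro f hf
      have h3 := hQ.1 f hf
      rw [map_smul, smul_eq_mul] at h3
      rw [map_neg]
      have : (tF F x)⁻¹ < 0 := inv_lt_zero.mpr htn
      by_contra hcon
      push Not at hcon
      nlinarith
    · left
      intro f hf
      have h3 := hQ.1 f hf
      rw [map_smul, smul_eq_mul] at h3
      exact nonneg_of_mul_nonneg_right h3 (inv_pos.mpr htp)


lemma exists_irr (F : Finset (W →ₗ[ℝ] ℝ)) : ∃ F' ⊆ F, coneF F' = coneF F ∧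
    ∀ f ∈ F', ∃ x, f x < 0 ∧ ∀ g ∈ F', g ≠ f → 0 ≤ g x := by
  classical
  induction F using Finset.strongInduction with
  | H F ih =>
    by_cases h : ∀ f ∈ F, ∃ x, f x < 0 ∧ ∀ g ∈ F, g ≠ f → 0 ≤ g x
    · exact ⟨F, subset_rfl, rfl, h⟩
    · push Not at h
      obtain ⟨f, hf, hx⟩ := h
      obtain ⟨F', h1, h2, h3⟩ := ih (F.erase f) (Finset.erase_ssubset hf)
      refine ⟨F', h1.trans (Finset.erase_subset _ _), ?_, h3⟩
      rw [h2]
      ext x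
      constructor
      · intro hx' g hg
        by_cases hgf : g = f
        · rw [hgf]
          by_contra hcon
          push Not at hcon
          obtain ⟨g', hg', hgf', hlt⟩ := hx x hcon
          exact absurd (hx' g' (Finset.mem_erase.mpr ⟨hgf', hg'⟩)) (not_le.mpr hlt)
        · exact hx' g (Finset.mem_erase.mpr ⟨hgf, hg⟩)
      · intro hx' g hg
        exact hx' g (Finset.mem_of_mem_erase hg)

lemma core_all (F : Finset (W →ₗ[ℝ] ℝ)) (hF : ∀ x, (∀ f ∈ F, f x = 0) → x = 0)
    (hW : Module.finrank ℝ W = 3) (y0 : W) (hy0 : ∀ f ∈ F, 0 < f y0) :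
    ∃ (F' : Finset (W →ₗ[ℝ] ℝ)) (V : Finset W) (L : W → (W →ₗ[ℝ] ℝ)) (l : W → ℝ) (ε : ℝ) (k : ℕ),
      ∀ x, (x ∈ coneF F ∨ -x ∈ coneF F) ↔
        (0 ≤ tF F' x ^ (2 * k) - GF F' V L l ε k x ∧ 0 ≤ ∏ f ∈ F', (tF F' x * f x)) := by
  obtain ⟨F', hsub, hc, hirr⟩ := exists_irr F
  have hF' : ∀ x, (∀ f ∈ F', f x = 0) → x = 0 := by
    intro x hx
    have h1 : x ∈ coneF F := by rw [← hc]; exact fun f hf => (hx f hf).ge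
    have h2 : -x ∈ coneF F := by rw [← hc]; exact fun f hf => by simp [hx f hf]
    refine hF x fun f hf => le_antisymm ?_ (h1 f hf)
    have := h2 f hf
    rw [map_neg] at this
    linarith
  obtain ⟨V, L, l, ε, k, h⟩ := core_irr F' hF' hW y0 (fun f hf => hy0 f (hsub hf)) hirr
  rw [← hc]
  exact ⟨F', V, L, l, ε, k, h⟩

end Core

/-- functions on the homogenized plane that restrict to polynomials -/
def PolyFn (h : E 2 × ℝ → ℝ) : Prop :=
  ∃ q : MvPolynomial (Fin 2) ℝ, ∀ x : E 2, evalPoly q x = h (x, 1)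

lemma PolyFn.lin (f : E 2 × ℝ →ₗ[ℝ] ℝ) : PolyFn fun x => f x := by
  refine ⟨MvPolynomial.C (f (EuclideanSpace.single 0 1, 0)) * MvPolynomial.X 0
    + MvPolynomial.C (f (EuclideanSpace.single 1 1, 0)) * MvPolynomial.X 1
    + MvPolynomial.C (f (0, 1)), fun x => ?_⟩
  have hx : ((x, 1) : E 2 × ℝ) = x 0 • ((EuclideanSpace.single 0 1, 0) : E 2 × ℝ)
      + x 1 • ((EuclideanSpace.single 1 1, 0) : E 2 × ℝ) + (0, 1) := by
    refine Prod.ext ?_ ?_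
    · ext i
      fin_cases i <;> simp
    · simp
  rw [hx]
  simp only [evalPoly, map_add, map_smul, smul_eq_mul, map_mul, MvPolynomial.eval_C,
    MvPolynomial.eval_X]
  ring

lemma PolyFn.const (c : ℝ) : PolyFn fun _ => c := ⟨MvPolynomial.C c, fun x => by simp [evalPoly]⟩

lemma PolyFn.add {f g : E 2 × ℝ → ℝ} (hf : PolyFn f) (hg : PolyFn g) :
    PolyFn fun x => f x + g x := by
  obtain ⟨p, hp⟩ := hf
  obtain ⟨q, hq⟩ := hg
  exact ⟨p + q, fun x => by simp only [← hp, ← hq]; simp [evalPoly]⟩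

lemma PolyFn.sub {f g : E 2 × ℝ → ℝ} (hf : PolyFn f) (hg : PolyFn g) :
    PolyFn fun x => f x - g x := by
  obtain ⟨p, hp⟩ := hf
  obtain ⟨q, hq⟩ := hg
  exact ⟨p - q, fun x => by simp only [← hp, ← hq]; simp [evalPoly]⟩

lemma PolyFn.mul {f g : E 2 × ℝ → ℝ} (hf : PolyFn f) (hg : PolyFn g) :
    PolyFn fun x => f x * g x := by
  obtain ⟨p, hp⟩ := hf
  obtain ⟨q, hq⟩ := hg
  exact ⟨p * q, fun x => by simp only [← hp, ← hq]; simp [evalPoly]⟩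

lemma PolyFn.pow {f : E 2 × ℝ → ℝ} (hf : PolyFn f) (n : ℕ) :
    PolyFn fun x => f x ^ n := by
  obtain ⟨p, hp⟩ := hf
  exact ⟨p ^ n, fun x => by simp only [← hp]; simp [evalPoly]⟩

lemma PolyFn.sum {ι : Type*} {f : ι → E 2 × ℝ → ℝ} (s : Finset ι) (hf : ∀ i, PolyFn (f i)) :
    PolyFn fun x => ∑ i ∈ s, f i x := by
  choose p hp using hf
  exact ⟨∑ i ∈ s, p i, fun x => by simp only [← hp]; simp [evalPoly]⟩

lemma PolyFn.prod {ι : Type*} {f : ι → E 2 × ℝ → ℝ} (s : Finset ι) (hf : ∀ i, PolyFn (f i)) :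
    PolyFn fun x => ∏ i ∈ s, f i x := by
  choose p hp using hf
  exact ⟨∏ i ∈ s, p i, fun x => by simp only [← hp]; simp [evalPoly, map_prod]⟩

lemma half_line {ι : Type*} (T : Finset ι) (c b : ι → ℝ) (hc : ∀ i ∈ T, 0 < c i) :
    ∃ α β : ℝ, ∀ s : ℝ, (∀ i ∈ T, c i * s ≤ b i) ↔ 0 ≤ α * s + β := by
  rcases T.eq_empty_or_nonempty with rfl | hT
  · exact ⟨0, 0, fun s => by simp⟩
  · obtain ⟨m, hm, hmin⟩ := Finset.exists_min_image T (fun i => b i / c i) hT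
    refine ⟨-1, b m / c m, fun s => ?_⟩
    have key : ∀ i ∈ T, (c i * s ≤ b i ↔ s ≤ b i / c i) := fun i hi => by
      rw [le_div_iff₀ (hc i hi), mul_comm]
    constructor
    · intro h
      have := (key m hm).1 (h m hm)
      linarith
    · intro h i hi
      have := hmin i hi
      exact (key i hi).2 (by linarith)

lemma line_case {ι : Type*} [Fintype ι] (c b : ι → ℝ) (hne : ∃ s : ℝ, ∀ i, c i * s ≤ b i) :
    ∃ α β α' β' : ℝ, ∀ s : ℝ, (∀ i, c i * s ≤ b i) ↔ (0 ≤ α * s + β ∧ 0 ≤ α' * s + β') := by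
  classical
  obtain ⟨α, β, h1⟩ := half_line (Finset.univ.filter fun i => 0 < c i) c b (by simp)
  obtain ⟨α', β', h2⟩ := half_line (Finset.univ.filter fun i => c i < 0) (fun i => - c i) b (by simp)
  refine ⟨α, β, -α', β', fun s => ?_⟩
  have h2' := h2 (-s)
  rw [← h1 s, show -α' * s + β' = α' * -s + β' by ring, ← h2']
  constructor
  · intro h
    exact ⟨fun i _ => h i, fun i _ => by simpa using h i⟩
  · rintro ⟨ha, hb⟩ i
    rcases lt_trichotomy (c i) 0 with hi | hi | hi
    · have := hb i (by simpa using hi)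
      simpa using this
    · obtain ⟨s0, hs0⟩ := hne
      have := hs0 i
      rw [hi] at this ⊢
      simpa using this
    · exact ha i (by simpa using hi)

/-- homogenized constraint -/
def hform (a : E 2) (b : ℝ) : E 2 × ℝ →ₗ[ℝ] ℝ :=
  b • LinearMap.snd ℝ (E 2) ℝ - (innerₗ (E 2) a).comp (LinearMap.fst ℝ (E 2) ℝ)

lemma hform_apply (a : E 2) (b : ℝ) (x : E 2) (z : ℝ) :
    hform a b (x, z) = b * z - ⟪a, x⟫ := by
  simp [hform]

/-- Every 2-dimensional polyhedron in ℝ² is the solution set of two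
polynomial inequalities. -/
theorem polyhedron_two_dim_two_polynomials
    (P : Set (E 2)) (hP : IsPolyhedron P) (hdim : dimS P = 2) :
    ∃ p₀ p₁ : MvPolynomial (Fin 2) ℝ,
      P = {x : E 2 | 0 ≤ evalPoly p₀ x ∧ 0 ≤ evalPoly p₁ x} := by
  classical
  obtain ⟨hne, m, a, b, hPe⟩ := hP
  have hmem : ∀ x, x ∈ P ↔ ∀ i, ⟪a i, x⟫ ≤ b i := by intro x; rw [hPe]; rfl
  by_cases hspan : ∀ x : E 2, (∀ i, ⟪a i, x⟫ = 0) → x = 0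
  · -- pointed case
    have hconv : Convex ℝ P := by
      intro x hx y hy s t hs ht hst
      rw [hmem] at hx hy ⊢
      intro i
      rw [inner_add_right, inner_smul_right, inner_smul_right]
      have h1 := mul_le_mul_of_nonneg_left (hx i) hs
      have h2 := mul_le_mul_of_nonneg_left (hy i) ht
      have h3 : s * b i + t * b i = b i := by rw [← add_mul, hst, one_mul]
      linarith
    have htop : affineSpan ℝ P = ⊤ := by
      rw [← AffineSubspace.direction_eq_top_iff_of_nonempty ((affineSpan_nonempty ℝ).mpr hne)]
      apply Submodule.eq_top_of_finrank_eq
      unfold dimS at hdim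
      rw [hdim]
      simp
    obtain ⟨p, hp⟩ := hconv.interior_nonempty_iff_affineSpan_eq_top.mpr htop
    have hpP : p ∈ P := interior_subset hp
    set F : Finset (E 2 × ℝ →ₗ[ℝ] ℝ) :=
      insert (LinearMap.snd ℝ (E 2) ℝ)
        ((Finset.univ.image fun i => hform (a i) (b i)).filter fun f => f ≠ 0) with hFdef
    have hFsnd : LinearMap.snd ℝ (E 2) ℝ ∈ F := by simp [hFdef]
    have hFi : ∀ i, hform (a i) (b i) ≠ 0 → hform (a i) (b i) ∈ F := by
      intro i hi
      simp only [hFdef, Finset.mem_insert, Finset.mem_filter, Finset.mem_image, Finset.mem_univ,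
        true_and]
      exact Or.inr ⟨⟨i, rfl⟩, hi⟩
    have hFcases : ∀ f ∈ F, f = LinearMap.snd ℝ (E 2) ℝ ∨
        (∃ i, f = hform (a i) (b i)) ∧ f ≠ 0 := by
      intro f hf
      simp only [hFdef, Finset.mem_insert, Finset.mem_filter, Finset.mem_image, Finset.mem_univ,
        true_and] at hf
      rcases hf with h | ⟨⟨i, h⟩, h'⟩
      · exact Or.inl h
      · exact Or.inr ⟨⟨i, h.symm⟩, h'⟩
    have hpt : ∀ x, (∀ f ∈ F, f x = 0) → x = 0 := by
      rintro ⟨x, z⟩ h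
      have hz : z = 0 := by simpa using h _ hFsnd
      subst hz
      have : x = 0 := by
        apply hspan
        intro i
        by_cases h0 : hform (a i) (b i) = 0
        · have := LinearMap.congr_fun h0 (x, 0)
          rw [hform_apply] at this
          simpa using this
        · have := h _ (hFi i h0)
          rw [hform_apply] at this
          simpa using this
      rw [this]; rfl
    have hpos : ∀ f ∈ F, 0 < f (p, 1) := by
      intro f hf
      rcases hFcases f hf with rfl | ⟨⟨i, rfl⟩, h0⟩
      · simp
      · rw [hform_apply]
        have h1 := (hmem p).1 hpP i
        rcases h1.lt_or_eq with h1 | h1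
        · linarith
        · exfalso
          have ha : a i ≠ 0 := by
            intro ha
            apply h0
            rw [ha, inner_zero_left] at h1
            refine LinearMap.ext ?_
            rintro ⟨x, z⟩
            rw [hform_apply, ha, ← h1]
            simp
          have hc : ContinuousAt (fun e : ℝ => p + e • a i) 0 := by fun_prop
          have hev := hc.eventually (show interior P ∈ nhds (p + (0:ℝ) • a i) by
            simpa using isOpen_interior.mem_nhds hp)
          have hev' : ∀ᶠ e in nhdsWithin (0:ℝ) (Set.Ioi 0), p + e • a i ∈ interior P :=
            hev.filter_mono nhdsWithin_le_nhds
          obtain ⟨e, he, he0⟩ := (hev'.and self_mem_nhdsWithin).exists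
          have h2 := (hmem _).1 (interior_subset he) i
          rw [inner_add_right, inner_smul_right, h1] at h2
          have h3 : 0 < ⟪a i, a i⟫ := real_inner_self_pos.mpr ha
          have := mul_pos he0 h3
          linarith
    have hcone : ∀ x : E 2, x ∈ P ↔ (((x, 1) : E 2 × ℝ) ∈ coneF F ∨ -((x, 1) : E 2 × ℝ) ∈ coneF F) := by
      intro x
      constructor
      · intro hx
        left
        intro f hf
        rcases hFcases f hf with rfl | ⟨⟨i, rfl⟩, h0⟩
        · simp
        · rw [hform_apply]
          have := (hmem x).1 hx i
          linarith
      · rintro (h | h)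
        · rw [hmem]
          intro i
          have : 0 ≤ hform (a i) (b i) (x, 1) := by
            by_cases h0 : hform (a i) (b i) = 0
            · rw [h0]; simp
            · exact h _ (hFi i h0)
          rw [hform_apply] at this
          linarith
        · have := h _ hFsnd
          simp at this
          linarith
    obtain ⟨F', V, L, l, ε, k, hmain⟩ := core_all F hpt (by simp) (p, 1) hpos
    obtain ⟨q0, hq0⟩ : PolyFn fun x => tF F' x ^ (2 * k) - GF F' V L l ε k x := by
      unfold GF
      refine ((PolyFn.lin _).pow _).sub (PolyFn.add ?_ ?_)
      · exact (PolyFn.const _).mul (PolyFn.sum _ fun f => (PolyFn.lin f).pow _)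
      · exact PolyFn.sum _ fun v => (PolyFn.const _).mul ((PolyFn.lin _).pow _)
    obtain ⟨q1, hq1⟩ : PolyFn fun x => ∏ f ∈ F', (tF F' x * f x) :=
      PolyFn.prod _ fun f => (PolyFn.lin _).mul (PolyFn.lin f)
    refine ⟨q0, q1, ?_⟩
    ext x
    rw [hcone, hmain]
    show _ ↔ 0 ≤ evalPoly q0 x ∧ 0 ≤ evalPoly q1 x
    rw [hq0, hq1]
  · -- degenerate case
    push Not at hspan
    obtain ⟨y, hy, hy0⟩ := hspan
    have hN : y 0 ^ 2 + y 1 ^ 2 ≠ 0 := by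
      intro h
      apply hy0
      have h0 : y 0 = 0 := by nlinarith [sq_nonneg (y 0), sq_nonneg (y 1)]
      have h1 : y 1 = 0 := by nlinarith [sq_nonneg (y 0), sq_nonneg (y 1)]
      ext i
      fin_cases i
      · simpa using h0
      · simpa using h1
    have hin : ∀ u v : E 2, ⟪u, v⟫ = u 0 * v 0 + u 1 * v 1 := by
      intro u v
      simp [PiLp.inner_apply, Fin.sum_univ_two]
      ring
    set c : Fin m → ℝ := fun i => (a i 1 * y 0 - a i 0 * y 1) / (y 0 ^ 2 + y 1 ^ 2) with hc
    have hac : ∀ i (x : E 2), ⟪a i, x⟫ = c i * (y 0 * x 1 - y 1 * x 0) := by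
      intro i x
      have h1 := hy i
      rw [hin] at h1
      rw [hin, hc]
      field_simp
      linear_combination (x 0 * y 0 + x 1 * y 1) * h1
    obtain ⟨x0, hx0⟩ := hne
    obtain ⟨α, β, α', β', h⟩ := line_case c b ⟨y 0 * x0 1 - y 1 * x0 0, fun i => by
      rw [← hac]; exact (hmem x0).1 hx0 i⟩
    let s : MvPolynomial (Fin 2) ℝ :=
      MvPolynomial.C (y 0) * MvPolynomial.X 1 - MvPolynomial.C (y 1) * MvPolynomial.X 0
    refine ⟨MvPolynomial.C α * s + MvPolynomial.C β, MvPolynomial.C α' * s + MvPolynomial.C β', ?_⟩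
    ext x
    rw [hmem]
    simp only [hac]
    rw [h]
    simp [evalPoly, s]
end
end

section
/- For every 3-dimensional polyhedron P in ℝ³ there exist three polynomials p₀, p₁, p₂ ∈ ℝ[x₁,x₂,x₃] such that P = {x ∈ ℝ³ : p₀(x) ≥ 0, p₁(x) ≥ 0 and p₂(x) ≥ 0}. -/
open scoped RealInnerProductSpace Pointwise
open Metric Set

noncomputable section

namespace PolyThree

set_option linter.unusedSectionVars false
set_option linter.unusedVariables false

open Filter Topology

variable {ι : Type} [Fintype ι] [DecidableEq ι]

/-- Sum of coordinates over a finite set. -/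
def u (A : Finset ι) (y : ι → ℝ) : ℝ := ∑ i ∈ A, y i

def phi (y : ι → ℝ) : ℝ := ∑ i, y i

def Q (A : Finset ι) (y : ι → ℝ) : ℝ := ∑ i ∈ A, y i ^ 2

def act (y : ι → ℝ) : Finset ι := Finset.univ.filter (fun i => y i = 0)

open Classical in
def VV (W : Submodule ℝ (ι → ℝ)) : Finset (Finset ι) :=
  Finset.univ.filter (fun A => 3 ≤ A.card ∧ ∃ v ∈ W, v ≠ 0 ∧ (∀ i, 0 ≤ v i) ∧ act v = A)

open Classical in
def EE (W : Submodule ℝ (ι → ℝ)) : Finset (Finset ι) :=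
  Finset.univ.filter (fun A => A.card = 2 ∧ ∃ v ∈ W, v ≠ 0 ∧ (∀ i, 0 ≤ v i) ∧ act v = A)

def VE (W : Submodule ℝ (ι → ℝ)) (e : Finset ι) : Finset (Finset ι) :=
  (VV W).filter (fun A => e ⊆ A)

def R (W : Submodule ℝ (ι → ℝ)) (y : ι → ℝ) : ℝ := ∏ A ∈ VV W, u A y
def rr (W : Submodule ℝ (ι → ℝ)) (y : ι → ℝ) : ℝ := ∏ A ∈ VV W, Q A y
def UY (W : Submodule ℝ (ι → ℝ)) (y : ι → ℝ) : ℝ :=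
  ∏ e ∈ EE W, (u e y * ∏ A ∈ VE W e, u A y)
def BB (W : Submodule ℝ (ι → ℝ)) (y : ι → ℝ) : ℝ := ∏ e ∈ EE W, Q e y
def MM (W : Submodule ℝ (ι → ℝ)) : ℕ := ∑ e ∈ EE W, (VE W e).card
def JJ (W : Submodule ℝ (ι → ℝ)) : ℕ := ∑ A ∈ VV W, A.card

def p0 (W : Submodule ℝ (ι → ℝ)) (N : ℕ) (y : ι → ℝ) : ℝ :=
  (Fintype.card ι : ℝ) * R W y * phi y ^ ((VV W).card + 2 * N)
    - rr W y * ∑ i, (phi y - y i) ^ (2 * N)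

def p1 (W : Submodule ℝ (ι → ℝ)) (C : ℝ) (N : ℕ) (y : ι → ℝ) : ℝ :=
  ((JJ W : ℝ) + 1) * C * UY W y * phi y ^ ((EE W).card + MM W) * R W y ^ (2 * N)
    - BB W y * phi y ^ (2 * MM W) *
      ∑ A ∈ VV W, ∑ i ∈ A, ((∏ A' ∈ (VV W).erase A, u A' y) * (u A y - y i)) ^ (2 * N)

def p2 (y : ι → ℝ) : ℝ := (∏ i, y i) * phi y ^ (Fintype.card ι)

/-! Basic lemmas -/

lemma u_smul (A : Finset ι) (t : ℝ) (y : ι → ℝ) : u A (t • y) = t * u A y := by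
  simp [u, Finset.mul_sum]
lemma phi_smul (t : ℝ) (y : ι → ℝ) : phi (t • y) = t * phi y := by
  simp [phi, Finset.mul_sum]
lemma Q_smul (A : Finset ι) (t : ℝ) (y : ι → ℝ) : Q A (t • y) = t ^ 2 * Q A y := by
  simp [Q, Finset.mul_sum, mul_pow]
lemma u_sub (A : Finset ι) (x y : ι → ℝ) : u A (x - y) = u A x - u A y := by
  simp [u]
lemma phi_sub (x y : ι → ℝ) : phi (x - y) = phi x - phi y := by
  simp [phi]
lemma u_add (A : Finset ι) (x y : ι → ℝ) : u A (x + y) = u A x + u A y := by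
  simp [u, Finset.sum_add_distrib]
lemma phi_add (x y : ι → ℝ) : phi (x + y) = phi x + phi y := by
  simp [phi, Finset.sum_add_distrib]
lemma R_smul (W : Submodule ℝ (ι → ℝ)) (t : ℝ) (y : ι → ℝ) :
    R W (t • y) = t ^ (VV W).card * R W y := by
  simp [R, u_smul, Finset.prod_mul_distrib]
lemma rr_smul (W : Submodule ℝ (ι → ℝ)) (t : ℝ) (y : ι → ℝ) :
    rr W (t • y) = t ^ (2 * (VV W).card) * rr W y := by
  simp [rr, Q_smul, Finset.prod_mul_distrib, pow_mul]
lemma BB_smul (W : Submodule ℝ (ι → ℝ)) (t : ℝ) (y : ι → ℝ) :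
    BB W (t • y) = t ^ (2 * (EE W).card) * BB W y := by
  simp [BB, Q_smul, Finset.prod_mul_distrib, pow_mul]
lemma UY_smul (W : Submodule ℝ (ι → ℝ)) (t : ℝ) (y : ι → ℝ) :
    UY W (t • y) = t ^ ((EE W).card + MM W) * UY W y := by
  simp only [UY, u_smul, Finset.prod_mul_distrib, Finset.prod_const, MM, pow_add,
    Finset.prod_pow_eq_pow_sum]
  ring

lemma p0_smul (W : Submodule ℝ (ι → ℝ)) (N : ℕ) (t : ℝ) (y : ι → ℝ) :
    p0 W N (t • y) = t ^ (2 * ((VV W).card + N)) * p0 W N y := by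
  have : ∑ i, (phi (t • y) - (t • y) i) ^ (2 * N) = t ^ (2 * N) * ∑ i, (phi y - y i) ^ (2 * N) := by
    rw [Finset.mul_sum]
    refine Finset.sum_congr rfl fun i _ => ?_
    rw [phi_smul, Pi.smul_apply, smul_eq_mul, ← mul_sub, mul_pow]
  unfold p0
  rw [this, R_smul, rr_smul, phi_smul]
  ring

lemma p1_smul (W : Submodule ℝ (ι → ℝ)) (C : ℝ) (N : ℕ) (t : ℝ) (y : ι → ℝ) :
    p1 W C N (t • y) = t ^ (2 * ((EE W).card + MM W + (VV W).card * N)) * p1 W C N y := by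
  have : ∑ A ∈ VV W, ∑ i ∈ A, ((∏ A' ∈ (VV W).erase A, u A' (t • y)) *
      (u A (t • y) - (t • y) i)) ^ (2 * N) = t ^ ((VV W).card * (2 * N)) *
      ∑ A ∈ VV W, ∑ i ∈ A, ((∏ A' ∈ (VV W).erase A, u A' y) * (u A y - y i)) ^ (2 * N) := by
    rw [Finset.mul_sum]
    refine Finset.sum_congr rfl fun A hA => ?_
    rw [Finset.mul_sum]
    refine Finset.sum_congr rfl fun i _ => ?_
    have hc : (VV W).card = ((VV W).erase A).card + 1 := by
      rw [Finset.card_erase_add_one hA]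
    simp only [u_smul, Finset.prod_mul_distrib, Finset.prod_const, Pi.smul_apply, smul_eq_mul]
    rw [← mul_sub, hc, pow_mul t, ← mul_pow]
    congr 1
    ring
  unfold p1
  rw [this, R_smul, BB_smul, UY_smul, phi_smul]
  ring

lemma p2_smul (t : ℝ) (y : ι → ℝ) :
    p2 (t • y) = t ^ (2 * Fintype.card ι) * p2 y := by
  simp only [p2, phi_smul, Pi.smul_apply, smul_eq_mul, Finset.prod_mul_distrib, Finset.prod_const,
    Finset.card_univ]
  ring

lemma Q_nonneg (A : Finset ι) (y : ι → ℝ) : 0 ≤ Q A y :=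
  Finset.sum_nonneg fun i _ => sq_nonneg _

lemma Q_eq_zero {A : Finset ι} {y : ι → ℝ} : Q A y = 0 ↔ ∀ i ∈ A, y i = 0 := by
  unfold Q
  rw [Finset.sum_eq_zero_iff_of_nonneg (fun i _ => sq_nonneg _)]
  simp

lemma u_nonneg (A : Finset ι) {y : ι → ℝ} (hy : ∀ i ∈ A, 0 ≤ y i) : 0 ≤ u A y :=
  Finset.sum_nonneg hy

lemma u_mono {A A' : Finset ι} (h : A ⊆ A') {y : ι → ℝ} (hy : ∀ i, 0 ≤ y i) : u A y ≤ u A' y :=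
  Finset.sum_le_sum_of_subset_of_nonneg h fun i _ _ => hy i

lemma u_le_phi (A : Finset ι) {y : ι → ℝ} (hy : ∀ i, 0 ≤ y i) : u A y ≤ phi y :=
  u_mono (Finset.subset_univ A) hy

lemma Q_le_sq (A : Finset ι) {y : ι → ℝ} (hy : ∀ i, 0 ≤ y i) : Q A y ≤ u A y ^ 2 := 
  Finset.sum_sq_le_sq_sum_of_nonneg (fun i _ => hy i)

lemma le_phi {y : ι → ℝ} (hy : ∀ i, 0 ≤ y i) (i : ι) : y i ≤ phi y :=
  Finset.single_le_sum (f := y) (fun i _ => hy i) (Finset.mem_univ i)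

lemma phi_nonneg {y : ι → ℝ} (hy : ∀ i, 0 ≤ y i) : 0 ≤ phi y :=
  Finset.sum_nonneg fun i _ => hy i

lemma phi_pos {y : ι → ℝ} (hy : ∀ i, 0 ≤ y i) (h0 : y ≠ 0) : 0 < phi y := by
  rcases (phi_nonneg hy).lt_or_eq with h | h
  · exact h
  · exfalso; apply h0
    have := (Finset.sum_eq_zero_iff_of_nonneg (fun i _ => hy i)).1 h.symm
    funext i; exact this i (Finset.mem_univ i)

lemma mem_act {y : ι → ℝ} {i : ι} : i ∈ act y ↔ y i = 0 := by simp [act]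

lemma act_smul {y : ι → ℝ} {t : ℝ} (ht : t ≠ 0) : act (t • y) = act y := by
  ext i; simp [mem_act, ht]

@[fun_prop] lemma cont_u (A : Finset ι) : Continuous (u A) := by unfold u; fun_prop
@[fun_prop] lemma cont_phi : Continuous (phi (ι := ι)) := by unfold phi; fun_prop
@[fun_prop] lemma cont_Q (A : Finset ι) : Continuous (Q A) := by unfold Q; fun_prop
@[fun_prop] lemma cont_R (W : Submodule ℝ (ι → ℝ)) : Continuous (R W) := by unfold R; fun_prop
@[fun_prop] lemma cont_rr (W : Submodule ℝ (ι → ℝ)) : Continuous (rr W) := by unfold rr; fun_prop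

/-- Compactness lemma. -/
lemma cl {X κ : Type} [TopologicalSpace X] [Fintype κ] {S : Set X} (hS : IsCompact S)
    (h : κ → X → ℝ) (hh : ∀ k, Continuous (h k)) (f : X → ℝ) (hf : Continuous f)
    (H : ∀ x ∈ S, (∀ k, h k x ≤ 0) → 0 < f x) :
    ∀ᶠ ε in 𝓝[>] (0 : ℝ), ∀ x ∈ S, (∀ k, h k x ≤ ε) → ε ≤ f x := by
  set g : X → ℝ := fun x => max (∑ k, max (h k x) 0) (f x) with hg
  have hgc : Continuous g := by fun_prop
  have hpos : ∀ x ∈ S, 0 < g x := by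
    intro x hx
    by_cases hk : ∀ k, h k x ≤ 0
    · exact lt_max_of_lt_right (H x hx hk)
    · push Not at hk
      obtain ⟨k, hk⟩ := hk
      apply lt_max_of_lt_left
      apply Finset.sum_pos' (fun i _ => le_max_right _ _)
      exact ⟨k, Finset.mem_univ k, lt_max_of_lt_left hk⟩
  have : ∃ c > 0, ∀ x ∈ S, c ≤ g x := by
    rcases S.eq_empty_or_nonempty with rfl | hne
    · exact ⟨1, one_pos, by simp⟩
    · obtain ⟨x0, hx0, hmin⟩ := hS.exists_isMinOn hne hgc.continuousOn
      exact ⟨g x0, hpos x0 hx0, fun x hx => hmin hx⟩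
  obtain ⟨c, hc, hcg⟩ := this
  have hb : 0 < c / (Fintype.card κ + 2) := by positivity
  filter_upwards [Ioo_mem_nhdsGT hb] with ε hε x hx hk
  have h1 := hcg x hx
  have hε0 := hε.1
  have hε1 : ε * (Fintype.card κ + 2) < c := by
    rw [← lt_div_iff₀ (by positivity)]; exact hε.2
  have h2 : ∑ k, max (h k x) 0 ≤ Fintype.card κ * ε := by
    calc ∑ k, max (h k x) 0 ≤ ∑ k : κ, ε := Finset.sum_le_sum fun k _ => max_le (hk k) hε0.le
      _ = _ := by simp
  rcases le_max_iff.1 h1 with h3 | h3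
  · nlinarith
  · have : (0:ℝ) ≤ Fintype.card κ := by positivity
    nlinarith

end PolyThree


namespace PolyThree

set_option linter.unusedSectionVars false
set_option linter.unusedVariables false

open Filter Topology

variable {ι : Type} [Fintype ι] [DecidableEq ι]

lemma H3 (W : Submodule ℝ (ι → ℝ)) (hdim : Module.finrank ℝ W ≤ 4)
    (hfac : ∀ i, ∃ z ∈ W, z i = 0 ∧ ∀ j, j ≠ i → 0 < z j)
    {i j k : ι} (hij : i ≠ j) (hik : i ≠ k) (hjk : j ≠ k)
    {y y' : ι → ℝ} (hy : y ∈ W) (hy' : y' ∈ W) (h0 : y ≠ 0)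
    (yi : y i = 0) (yj : y j = 0) (yk : y k = 0)
    (yi' : y' i = 0) (yj' : y' j = 0) (yk' : y' k = 0) : ∃ t : ℝ, y' = t • y := by
  by_contra hcon
  push Not at hcon
  obtain ⟨a, haW, ha0, ha⟩ := hfac i
  obtain ⟨b, hbW, hb0, hb⟩ := hfac j
  obtain ⟨c, hcW, hc0, hc⟩ := hfac k
  let f : Fin 5 → W := ![⟨y, hy⟩, ⟨y', hy'⟩, ⟨a, haW⟩, ⟨b, hbW⟩, ⟨c, hcW⟩]
  have hf : LinearIndependent ℝ f := by
    rw [Fintype.linearIndependent_iff]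
    intro g hg
    have hg' : g 0 • y + g 1 • y' + g 2 • a + g 3 • b + g 4 • c = 0 := by
      have := congrArg Subtype.val hg
      simpa [f, Fin.sum_univ_succ, add_assoc] using this
    have ei := congrFun hg' i
    have ej := congrFun hg' j
    have ek := congrFun hg' k
    simp only [Pi.add_apply, Pi.smul_apply, smul_eq_mul, Pi.zero_apply, yi, yj, yk, yi', yj', yk',
      ha0, hb0, hc0, mul_zero, zero_add, add_zero] at ei ej ek
    have a1 := ha j hij.symm
    have a2 := ha k hik.symm
    have b1 := hb i hij
    have b2 := hb k hjk.symm
    have c1 := hc i hik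
    have c2 := hc j hjk
    have hD : 0 < a j * b k * c i + a k * b i * c j := by positivity
    have g2 : g 2 = 0 := by
      have : g 2 * (a j * b k * c i + a k * b i * c j) = 0 := by
        linear_combination (b k * c i) * ej - b k * c j * ei + b i * c j * ek
      rcases mul_eq_zero.1 this with h | h
      · exact h
      · exact absurd h hD.ne'
    have g3 : g 3 = 0 := by
      rw [g2] at ek
      have : g 3 * b k = 0 := by linarith
      exact (mul_eq_zero.1 this).resolve_right b2.ne'
    have g4 : g 4 = 0 := by
      rw [g2] at ej
      have : g 4 * c j = 0 := by linarith
      exact (mul_eq_zero.1 this).resolve_right c2.ne'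
    rw [g2, g3, g4] at hg'
    simp only [zero_smul, add_zero] at hg'
    have g1 : g 1 = 0 := by
      by_contra h1
      apply hcon (-(g 1)⁻¹ * g 0)
      have : y' = (g 1)⁻¹ • (g 1 • y') := by rw [smul_smul, inv_mul_cancel₀ h1, one_smul]
      rw [this, eq_neg_of_add_eq_zero_right hg', smul_neg, smul_smul, ← neg_smul, neg_mul]
    rw [g1] at hg'
    simp only [zero_smul, add_zero] at hg'
    have g0 : g 0 = 0 := (smul_eq_zero.1 hg').resolve_right h0
    intro l
    fin_cases l <;> assumption
  have := hf.fintype_card_le_finrank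
  simp at this
  omega

lemma H2 (W : Submodule ℝ (ι → ℝ)) (hdim : Module.finrank ℝ W ≤ 4)
    (hfac : ∀ i, ∃ z ∈ W, z i = 0 ∧ ∀ j, j ≠ i → 0 < z j)
    {i j : ι} (hij : i ≠ j)
    {x y w : ι → ℝ} (hx : x ∈ W) (hy : y ∈ W) (hw : w ∈ W)
    (hind : ∀ s t : ℝ, s • x + t • y = 0 → s = 0 ∧ t = 0)
    (xi : x i = 0) (xj : x j = 0)
    (yi : y i = 0) (yj : y j = 0)
    (wi : w i = 0) (wj : w j = 0) : ∃ s t : ℝ, w = s • x + t • y := by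
  by_contra hcon
  push Not at hcon
  obtain ⟨a, haW, ha0, ha⟩ := hfac i
  obtain ⟨b, hbW, hb0, hb⟩ := hfac j
  let f : Fin 5 → W := ![⟨x, hx⟩, ⟨y, hy⟩, ⟨w, hw⟩, ⟨a, haW⟩, ⟨b, hbW⟩]
  have hf : LinearIndependent ℝ f := by
    rw [Fintype.linearIndependent_iff]
    intro g hg
    have hg' : g 0 • x + g 1 • y + g 2 • w + g 3 • a + g 4 • b = 0 := by
      have := congrArg Subtype.val hg
      simpa [f, Fin.sum_univ_succ, add_assoc] using this
    have ei := congrFun hg' i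
    have ej := congrFun hg' j
    simp only [Pi.add_apply, Pi.smul_apply, smul_eq_mul, Pi.zero_apply, yi, yj, xi, xj, wi, wj,
      ha0, hb0, mul_zero, zero_add, add_zero] at ei ej
    have a1 := ha j hij.symm
    have b1 := hb i hij
    have g3 : g 3 = 0 := (mul_eq_zero.1 ej).resolve_right a1.ne'
    have g4 : g 4 = 0 := (mul_eq_zero.1 ei).resolve_right b1.ne'
    rw [g3, g4] at hg'
    simp only [zero_smul, add_zero] at hg'
    have g2 : g 2 = 0 := by
      by_contra h1
      apply hcon (-(g 2)⁻¹ * g 0) (-(g 2)⁻¹ * g 1)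
      have : w = (g 2)⁻¹ • (g 2 • w) := by rw [smul_smul, inv_mul_cancel₀ h1, one_smul]
      rw [this, eq_neg_of_add_eq_zero_right hg']
      module
    rw [g2] at hg'
    simp only [zero_smul, add_zero] at hg'
    obtain ⟨g0, g1⟩ := hind _ _ hg'
    intro l
    fin_cases l <;> assumption
  have := hf.fintype_card_le_finrank
  simp at this
  omega

/-- Standing hypotheses. -/
structure Hyp (W : Submodule ℝ (ι → ℝ)) : Prop where
  hdim : Module.finrank ℝ W ≤ 4
  hfac : ∀ i, ∃ z ∈ W, z i = 0 ∧ ∀ j, j ≠ i → 0 < z j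

/-- `v` is the normalized vertex with active set `A`. -/
structure Vert (W : Submodule ℝ (ι → ℝ)) (A : Finset ι) (v : ι → ℝ) : Prop where
  memW : v ∈ W
  phi1 : phi v = 1
  nonneg : ∀ i, 0 ≤ v i
  act : act v = A

lemma exists_norm {W : Submodule ℝ (ι → ℝ)} {A : Finset ι}
    (h : ∃ v ∈ W, v ≠ 0 ∧ (∀ i, 0 ≤ v i) ∧ act v = A) : ∃ v, Vert W A v := by
  obtain ⟨v, hv, h0, hn, hA⟩ := h
  have hp := phi_pos hn h0
  refine ⟨(phi v)⁻¹ • v, W.smul_mem _ hv, ?_, ?_, ?_⟩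
  · rw [phi_smul, inv_mul_cancel₀ hp.ne']
  · intro i
    have := hn i
    simp only [Pi.smul_apply, smul_eq_mul]
    positivity
  · rw [act_smul (inv_ne_zero hp.ne'), hA]

lemma VV_card {W : Submodule ℝ (ι → ℝ)} {A : Finset ι} (hA : A ∈ VV W) : 3 ≤ A.card := by
  simp only [VV, Finset.mem_filter] at hA
  exact hA.2.1
lemma VV_vert {W : Submodule ℝ (ι → ℝ)} {A : Finset ι} (hA : A ∈ VV W) : ∃ v, Vert W A v := by
  simp only [VV, Finset.mem_filter] at hA
  exact exists_norm hA.2.2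
lemma EE_card {W : Submodule ℝ (ι → ℝ)} {A : Finset ι} (hA : A ∈ EE W) : A.card = 2 := by
  simp only [EE, Finset.mem_filter] at hA
  exact hA.2.1
lemma EE_vert {W : Submodule ℝ (ι → ℝ)} {A : Finset ι} (hA : A ∈ EE W) : ∃ v, Vert W A v := by
  simp only [EE, Finset.mem_filter] at hA
  exact exists_norm hA.2.2

lemma phi_zero : phi (0 : ι → ℝ) = 0 := by simp [phi]

lemma Vert.ne_zero {W : Submodule ℝ (ι → ℝ)} {A : Finset ι} {v : ι → ℝ} (h : Vert W A v) :
    v ≠ 0 := by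
  rintro rfl
  have := h.phi1
  rw [phi_zero] at this
  norm_num at this

lemma Vert.mem {W : Submodule ℝ (ι → ℝ)} {A : Finset ι} {v : ι → ℝ} (h : Vert W A v) {i : ι} :
    i ∈ A ↔ v i = 0 := by
  rw [← h.act, mem_act]

lemma mem_VV {W : Submodule ℝ (ι → ℝ)} {A : Finset ι} {v : ι → ℝ} (h : Vert W A v)
    (hc : 3 ≤ A.card) : A ∈ VV W := by
  simp only [VV, Finset.mem_filter, Finset.mem_univ, true_and]
  exact ⟨hc, v, h.memW, h.ne_zero, h.nonneg, h.act⟩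
lemma mem_EE {W : Submodule ℝ (ι → ℝ)} {A : Finset ι} {v : ι → ℝ} (h : Vert W A v)
    (hc : A.card = 2) : A ∈ EE W := by
  simp only [EE, Finset.mem_filter, Finset.mem_univ, true_and]
  exact ⟨hc, v, h.memW, h.ne_zero, h.nonneg, h.act⟩

/-- Vectors vanishing on a set of at least three common zeros are multiples of the vertex. -/
lemma H3' {W : Submodule ℝ (ι → ℝ)} (hW : Hyp W) {B : Finset ι} (hB : 3 ≤ B.card)
    {y v : ι → ℝ} (hv : v ∈ W) (hv1 : phi v = 1) (hvB : ∀ i ∈ B, v i = 0)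
    (hy : y ∈ W) (hyB : ∀ i ∈ B, y i = 0) : y = phi y • v := by
  obtain ⟨i, j, k, hi, hj, hk, hij, hik, hjk⟩ := Finset.two_lt_card_iff.1 (show 2 < B.card from hB)
  have h0 : v ≠ 0 := by
    rintro rfl
    rw [phi_zero] at hv1; norm_num at hv1
  obtain ⟨t, ht⟩ := H3 W hW.hdim hW.hfac hij hik hjk hv hy h0 (hvB i hi) (hvB j hj) (hvB k hk)
    (hyB i hi) (hyB j hj) (hyB k hk)
  have : phi y = t := by rw [ht, phi_smul, hv1, mul_one]
  rw [this]; exact ht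

lemma u_eq_zero {A : Finset ι} {y : ι → ℝ} (hy : ∀ i ∈ A, 0 ≤ y i) (h : u A y ≤ 0) :
    ∀ i ∈ A, y i = 0 := 
  (Finset.sum_eq_zero_iff_of_nonneg hy).1 (le_antisymm h (u_nonneg A hy))

/-- local structure at a vertex -/
lemma local_struct {W : Submodule ℝ (ι → ℝ)} (hW : Hyp W) {A : Finset ι} (hA : A ∈ VV W)
    {z : ι → ℝ} (hz : z ∈ W) (hz1 : phi z = 0) (hz0 : z ≠ 0) (hpos : ∀ i ∈ A, 0 ≤ z i)
    {e : Finset ι} (he : e.card = 2) (heA : e ⊆ A) (hez : ∀ i ∈ e, z i = 0) :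
    e ∈ EE W ∧ ∀ i ∈ A, z i = 0 → i ∈ e := by
  obtain ⟨v, hv⟩ := VV_vert hA
  have hex : ∀ i ∈ A, z i = 0 → i ∈ e := by
    intro i hi hzi
    by_contra hie
    have hc : 3 ≤ (insert i e).card := by rw [Finset.card_insert_of_notMem hie, he]
    have := H3' hW hc hv.memW hv.phi1 (y := z) (by
      intro j hj
      rw [Finset.mem_insert] at hj
      rcases hj with rfl | hj
      · exact hv.mem.1 hi
      · exact hv.mem.1 (heA hj)) hz (by
      intro j hj
      rw [Finset.mem_insert] at hj
      rcases hj with rfl | hj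
      · exact hzi
      · exact hez j hj)
    rw [hz1, zero_smul] at this
    exact hz0 this
  refine ⟨?_, hex⟩
  have hev : ∀ᶠ t in 𝓝[>] (0:ℝ), ∀ i, i ∉ A → 0 < v i + t * z i := by
    rw [eventually_all]
    intro i
    by_cases hi : i ∈ A
    · exact Eventually.of_forall fun t h => absurd hi h
    · have hvi : 0 < v i := lt_of_le_of_ne (hv.nonneg i) (fun h => hi (hv.mem.2 h.symm))
      have hc : Tendsto (fun t : ℝ => v i + t * z i) (𝓝[>] 0) (𝓝 (v i)) := by
        have : Continuous (fun t : ℝ => v i + t * z i) := by fun_prop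
        have h2 := this.tendsto 0
        simp only [zero_mul, add_zero] at h2
        exact h2.mono_left nhdsWithin_le_nhds
      filter_upwards [hc.eventually (lt_mem_nhds hvi)] with t ht _ using ht
  obtain ⟨t, ht, ht0⟩ := (hev.and self_mem_nhdsWithin).exists
  have ht0 : 0 < t := ht0
  have hvA : ∀ i ∈ A, v i = 0 := fun i hi => hv.mem.1 hi
  refine mem_EE (v := v + t • z) ⟨W.add_mem hv.memW (W.smul_mem _ hz), ?_, ?_, ?_⟩ he
  · rw [phi_add, phi_smul, hz1, hv.phi1]; simp
  · intro i
    simp only [Pi.add_apply, Pi.smul_apply, smul_eq_mul]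
    by_cases hi : i ∈ A
    · rw [hvA i hi]
      have := hpos i hi
      positivity
    · exact (ht i hi).le
  · ext i
    rw [mem_act]
    simp only [Pi.add_apply, Pi.smul_apply, smul_eq_mul]
    by_cases hi : i ∈ A
    · rw [hvA i hi, zero_add]
      constructor
      · intro h
        exact hex i hi ((mul_eq_zero.1 h).resolve_left ht0.ne')
      · intro h
        rw [hez i h, mul_zero]
    · constructor
      · intro h
        exact absurd h (ht i hi).ne'
      · intro h
        exact absurd (heA h) hi

lemma edge_pos {e e' : Finset ι} (he : e.card = 2) (he' : e'.card = 2) (hne : e' ≠ e)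
    {z : ι → ℝ} (hpos : ∀ i ∈ e', 0 ≤ z i) (hex : ∀ i ∈ e', z i = 0 → i ∈ e) : 0 < u e' z := by
  by_contra h
  have := u_eq_zero hpos (not_lt.1 h)
  apply hne
  apply Finset.eq_of_subset_of_card_le
  · intro i hi
    exact hex i hi (this i hi)
  · omega

/-- global structure away from vertices -/
lemma global_struct {W : Submodule ℝ (ι → ℝ)} {y : ι → ℝ} (hy : y ∈ W) (hy1 : phi y = 1)
    (hpos : ∀ i, 0 ≤ y i) (hV : ∀ A ∈ VV W, 0 < u A y)
    {e : Finset ι} (he : e.card = 2) (hez : ∀ i ∈ e, y i = 0) :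
    e ∈ EE W ∧ ∀ i, y i = 0 → i ∈ e := by
  have hv : Vert W (act y) y := ⟨hy, hy1, hpos, rfl⟩
  have hsub : e ⊆ act y := fun i hi => mem_act.2 (hez i hi)
  have hcard : (act y).card ≤ 2 := by
    by_contra h
    have := hV _ (mem_VV hv (by omega))
    have h0 : u (act y) y = 0 := Finset.sum_eq_zero fun i hi => mem_act.1 hi
    linarith
  have heq : e = act y := Finset.eq_of_subset_of_card_le hsub (by omega)
  refine ⟨?_, ?_⟩
  · exact heq ▸ mem_EE hv (by rw [← heq]; exact he)
  · intro i hi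
    rw [heq]; exact mem_act.2 hi

lemma vert_unique {W : Submodule ℝ (ι → ℝ)} (hW : Hyp W) {A : Finset ι} (hA : A ∈ VV W)
    {y v : ι → ℝ} (hv : Vert W A v) (hy : y ∈ W) (hy1 : phi y = 1) (hyA : ∀ i ∈ A, y i = 0) :
    y = v := by
  have := H3' hW (VV_card hA) hv.memW hv.phi1 (fun i hi => hv.mem.1 hi) hy hyA
  rw [hy1, one_smul] at this
  exact this

end PolyThree


namespace PolyThree

set_option linter.unusedSectionVars false
set_option linter.unusedVariables false

open Filter Topology

variable {ι : Type} [Fintype ι] [DecidableEq ι]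

def S1 (W : Submodule ℝ (ι → ℝ)) : Set (ι → ℝ) := {y | y ∈ W ∧ phi y = 1 ∧ ∀ i, -1 ≤ y i}

def SZ (W : Submodule ℝ (ι → ℝ)) : Set (ι → ℝ) := {z | z ∈ W ∧ phi z = 0 ∧ ‖z‖ = 1}

lemma S1_le {W : Submodule ℝ (ι → ℝ)} {y : ι → ℝ} (hy : y ∈ S1 W) (i : ι) :
    y i ≤ Fintype.card ι := by
  have h1 : y i + 1 ≤ ∑ j, (y j + 1) :=
    Finset.single_le_sum (f := fun j => y j + 1) (fun j _ => by linarith [hy.2.2 j])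
      (Finset.mem_univ i)
  rw [Finset.sum_add_distrib] at h1
  have h2 : ∑ j, y j = 1 := hy.2.1
  rw [h2] at h1
  simp at h1
  linarith

lemma S1_compact (W : Submodule ℝ (ι → ℝ)) : IsCompact (S1 W) := by
  apply IsCompact.of_isClosed_subset (isCompact_Icc (a := fun _ : ι => (-1:ℝ))
    (b := fun _ : ι => (Fintype.card ι : ℝ)))
  · have h1 : IsClosed (W : Set (ι → ℝ)) := W.closed_of_finiteDimensional
    have h2 : IsClosed {y : ι → ℝ | phi y = 1} := isClosed_eq cont_phi continuous_const
    have h3 : IsClosed {y : ι → ℝ | ∀ i, -1 ≤ y i} := by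
      simp only [Set.ofPred_forall]
      exact isClosed_iInter fun i => isClosed_le continuous_const (continuous_apply i)
    exact h1.inter (h2.inter h3)
  · intro y hy
    exact ⟨fun i => hy.2.2 i, fun i => S1_le hy i⟩

lemma SZ_compact (W : Submodule ℝ (ι → ℝ)) : IsCompact (SZ W) := by
  apply IsCompact.of_isClosed_subset (isCompact_sphere (0 : ι → ℝ) 1)
  · have h1 : IsClosed (W : Set (ι → ℝ)) := W.closed_of_finiteDimensional
    have h2 : IsClosed {y : ι → ℝ | phi y = 0} := isClosed_eq cont_phi continuous_const
    have h3 : IsClosed {y : ι → ℝ | ‖y‖ = 1} := isClosed_eq continuous_norm continuous_const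
    exact h1.inter (h2.inter h3)
  · intro y hy
    simpa using hy.2.2

lemma SZ_ne {W : Submodule ℝ (ι → ℝ)} {z : ι → ℝ} (hz : z ∈ SZ W) : z ≠ 0 := by
  rintro rfl
  have := hz.2.2
  simp at this

lemma abs_u_le (A : Finset ι) (z : ι → ℝ) {b : ℝ} (hz : ∀ i, |z i| ≤ b) (hb : 0 ≤ b) :
    |u A z| ≤ Fintype.card ι * b := by
  calc |u A z| ≤ ∑ i ∈ A, |z i| := Finset.abs_sum_le_sum_abs _ _
    _ ≤ ∑ i ∈ A, b := Finset.sum_le_sum fun i _ => hz i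
    _ = A.card * b := by simp
    _ ≤ _ := by
      gcongr
      exact Finset.card_le_univ A

lemma SZ_u_le {W : Submodule ℝ (ι → ℝ)} {z : ι → ℝ} (hz : z ∈ SZ W) (A : Finset ι) :
    |u A z| ≤ Fintype.card ι := by
  have := abs_u_le A z (b := 1) (fun i => by
    have := norm_le_pi_norm z i
    rw [hz.2.2] at this
    simpa using this) zero_le_one
  simpa using this

lemma F1 {W : Submodule ℝ (ι → ℝ)} (hW : Hyp W) :
    ∀ᶠ ε in 𝓝[>] (0:ℝ), ∀ A ∈ VV W, ∀ A' ∈ VV W, A ≠ A' → ∀ y ∈ S1 W, (∀ i, -y i ≤ ε) →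
      ε ≤ max (u A y) (u A' y) := by
  simp only [Filter.eventually_all_finset, Filter.eventually_all]
  intro A hA A' hA' hne
  refine cl (S1_compact W) (fun i y => -y i) (fun i => by fun_prop) _ (by fun_prop) ?_
  intro y hy hk
  have hpos : ∀ i, 0 ≤ y i := fun i => by linarith [hk i]
  by_contra h
  have h := not_lt.1 h
  have h1 := u_eq_zero (fun i _ => hpos i) ((le_max_left _ _).trans h)
  have h2 := u_eq_zero (fun i _ => hpos i) ((le_max_right _ _).trans h)
  obtain ⟨v, hv⟩ := VV_vert hA
  obtain ⟨v', hv'⟩ := VV_vert hA'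
  have e1 := vert_unique hW hA hv hy.1 hy.2.1 h1
  have e2 := vert_unique hW hA' hv' hy.1 hy.2.1 h2
  apply hne
  rw [← hv.act, ← hv'.act, ← e1, ← e2]

lemma F2 {W : Submodule ℝ (ι → ℝ)} (hW : Hyp W) :
    ∀ᶠ ε in 𝓝[>] (0:ℝ), ∀ A ∈ VV W, ∀ j, j ∉ A → ∀ y ∈ S1 W, (∀ i, -y i ≤ ε) →
      u A y ≤ ε → ε ≤ y j := by
  simp only [Filter.eventually_all_finset, Filter.eventually_all]
  intro A hA j hj
  have := cl (κ := Option ι) (S1_compact W) (fun i y => i.elim (u A y) (fun i => -y i))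
    (fun i => by cases i <;> simp only [Option.elim] <;> fun_prop) (fun y => y j) (by fun_prop) (by
      intro y hy hk
      have hpos : ∀ i, 0 ≤ y i := fun i => by
        have := hk (some i)
        simp only [Option.elim] at this
        linarith
      have h1 := u_eq_zero (fun i _ => hpos i) (hk none)
      obtain ⟨v, hv⟩ := VV_vert hA
      have e1 := vert_unique hW hA hv hy.1 hy.2.1 h1
      refine lt_of_le_of_ne (hpos j) fun h => hj ?_
      rw [hv.mem, ← e1]; exact h.symm)
  filter_upwards [this] with ε hε y hy h1 h2
  refine hε y hy ?_
  rintro (_ | i)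
  · exact h2
  · exact h1 i

lemma F3 {W : Submodule ℝ (ι → ℝ)} (hW : Hyp W) :
    ∀ᶠ ε in 𝓝[>] (0:ℝ), ∀ A ∈ VV W, ∀ i ∈ A, ∀ j ∈ A, i ≠ j → {i, j} ∉ EE W →
      ∀ z ∈ SZ W, (∀ k ∈ A, -z k ≤ ε) → ε ≤ max (z i) (z j) := by
  simp only [Filter.eventually_all_finset, Filter.eventually_all]
  intro A hA i hi j hj hij hE
  have := cl (κ := {k // k ∈ A}) (SZ_compact W) (fun k z => -z k) (fun k => by fun_prop)
    (fun z => max (z i) (z j)) (by fun_prop) (by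
      intro z hz hk
      by_contra h
      have h := not_lt.1 h
      apply hE
      have hpos : ∀ k ∈ A, 0 ≤ z k := fun k hkA => by linarith [hk ⟨k, hkA⟩]
      refine (local_struct hW hA hz.1 hz.2.1 (SZ_ne hz) hpos (Finset.card_pair hij) ?_ ?_).1
      · intro k hk
        simp only [Finset.mem_insert, Finset.mem_singleton] at hk
        rcases hk with rfl | rfl <;> assumption
      · intro k hk
        simp only [Finset.mem_insert, Finset.mem_singleton] at hk
        rcases hk with rfl | rfl
        · exact le_antisymm ((le_max_left _ _).trans h) (hpos _ hi)
        · exact le_antisymm ((le_max_right _ _).trans h) (hpos _ hj))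
  filter_upwards [this] with ε hε z hz h1
  exact hε z hz fun k => h1 k k.2

lemma F4 {W : Submodule ℝ (ι → ℝ)} (hW : Hyp W) :
    ∀ᶠ ε in 𝓝[>] (0:ℝ), ∀ A ∈ VV W, ∀ i ∈ A, ∀ j ∈ A, i ≠ j → ∀ e' ∈ EE W, e' ⊆ A →
      e' ≠ {i, j} → 
      ∀ z ∈ SZ W, (∀ k ∈ A, -z k ≤ ε) → ε ≤ max (max (z i) (z j)) (u e' z) := by
  simp only [Filter.eventually_all_finset, Filter.eventually_all]
  intro A hA i hi j hj hij e' he' heA hne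
  have := cl (κ := {k // k ∈ A}) (SZ_compact W) (fun k z => -z k) (fun k => by fun_prop)
    (fun z => max (max (z i) (z j)) (u e' z)) (by fun_prop) (by
      intro z hz hk
      by_cases h : 0 < max (z i) (z j)
      · exact lt_max_of_lt_left h
      have h := not_lt.1 h
      apply lt_max_of_lt_right
      have hpos : ∀ k ∈ A, 0 ≤ z k := fun k hkA => by linarith [hk ⟨k, hkA⟩]
      have := (local_struct hW hA hz.1 hz.2.1 (SZ_ne hz) hpos (Finset.card_pair hij) (by
        intro k hk
        simp only [Finset.mem_insert, Finset.mem_singleton] at hk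
        rcases hk with rfl | rfl <;> assumption) (by
        intro k hk
        simp only [Finset.mem_insert, Finset.mem_singleton] at hk
        rcases hk with rfl | rfl
        · exact le_antisymm ((le_max_left _ _).trans h) (hpos _ hi)
        · exact le_antisymm ((le_max_right _ _).trans h) (hpos _ hj))).2
      exact edge_pos (Finset.card_pair hij) (EE_card he') hne (fun k hk => hpos k (heA hk))
        (fun k hk => this k (heA hk)))
  filter_upwards [this] with ε hε z hz h1
  exact hε z hz fun k => h1 k k.2

lemma F5 {W : Submodule ℝ (ι → ℝ)} {κ : ℝ} (hκ : 0 < κ) :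
    ∀ᶠ ε in 𝓝[>] (0:ℝ), ∀ i j, i ≠ j → {i, j} ∉ EE W → 
      ∀ y ∈ S1 W, (∀ k, -y k ≤ ε) → (∀ A ∈ VV W, κ ≤ u A y) → 0 < max (y i) (y j) := by
  simp only [Filter.eventually_all]
  intro i j hij hE
  have := cl (κ := ι ⊕ {A // A ∈ VV W}) (S1_compact W)
    (fun k y => Sum.elim (fun i => -y i) (fun A : {A // A ∈ VV W} => κ - u A.1 y) k) 
    (fun k => by cases k <;> simp only [Sum.elim_inl, Sum.elim_inr] <;> fun_prop)
    (fun z => max (z i) (z j)) (by fun_prop) (by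
      intro y hy hk
      by_contra h
      have h := not_lt.1 h
      apply hE
      have hpos : ∀ k, 0 ≤ y k := fun k => by
        have := hk (Sum.inl k)
        simp only [Sum.elim_inl] at this
        linarith
      refine (global_struct hy.1 hy.2.1 hpos ?_ (Finset.card_pair hij) ?_).1
      · intro A hA
        have := hk (Sum.inr ⟨A, hA⟩)
        simp only [Sum.elim_inr] at this
        linarith
      · intro k hk
        simp only [Finset.mem_insert, Finset.mem_singleton] at hk
        rcases hk with rfl | rfl
        · exact le_antisymm ((le_max_left _ _).trans h) (hpos _)
        · exact le_antisymm ((le_max_right _ _).trans h) (hpos _))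
  filter_upwards [this, self_mem_nhdsWithin] with ε hε hε0 y hy h1 h2
  have hε0 : 0 < ε := hε0
  refine lt_of_lt_of_le hε0 (hε y hy ?_)
  rintro (k | ⟨A, hA⟩)
  · exact h1 k
  · simp only [Sum.elim_inr]
    linarith [h2 A hA]

lemma F6 {W : Submodule ℝ (ι → ℝ)} {κ : ℝ} (hκ : 0 < κ) :
    ∀ᶠ ε in 𝓝[>] (0:ℝ), ∀ i j, i ≠ j → ∀ e' ∈ EE W, e' ≠ {i, j} → 
      ∀ y ∈ S1 W, (∀ k, -y k ≤ ε) → (∀ A ∈ VV W, κ ≤ u A y) →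
        0 < max (max (y i) (y j)) (u e' y) := by
  simp only [Filter.eventually_all_finset, Filter.eventually_all]
  intro i j hij e' he' hne
  have := cl (κ := ι ⊕ {A // A ∈ VV W}) (S1_compact W)
    (fun k y => Sum.elim (fun i => -y i) (fun A : {A // A ∈ VV W} => κ - u A.1 y) k) 
    (fun k => by cases k <;> simp only [Sum.elim_inl, Sum.elim_inr] <;> fun_prop)
    (fun z => max (max (z i) (z j)) (u e' z)) (by fun_prop) (by
      intro y hy hk
      by_cases h : 0 < max (y i) (y j)
      · exact lt_max_of_lt_left h
      have h := not_lt.1 h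
      apply lt_max_of_lt_right
      have hpos : ∀ k, 0 ≤ y k := fun k => by
        have := hk (Sum.inl k)
        simp only [Sum.elim_inl] at this
        linarith
      have := (global_struct hy.1 hy.2.1 hpos (by
        intro A hA
        have := hk (Sum.inr ⟨A, hA⟩)
        simp only [Sum.elim_inr] at this
        linarith) (Finset.card_pair hij) (by
        intro k hk
        simp only [Finset.mem_insert, Finset.mem_singleton] at hk
        rcases hk with rfl | rfl
        · exact le_antisymm ((le_max_left _ _).trans h) (hpos _)
        · exact le_antisymm ((le_max_right _ _).trans h) (hpos _))).2
      exact edge_pos (Finset.card_pair hij) (EE_card he') hne (fun k hk => hpos k)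
        (fun k hk => this k))
  filter_upwards [this, self_mem_nhdsWithin] with ε hε hε0 y hy h1 h2
  have hε0 : 0 < ε := hε0
  refine lt_of_lt_of_le hε0 (hε y hy ?_)
  rintro (k | ⟨A, hA⟩)
  · exact h1 k
  · simp only [Sum.elim_inr]
    linarith [h2 A hA]

/-- Sphere estimate used in step C. -/
lemma F7 {W : Submodule ℝ (ι → ℝ)} (hW : Hyp W) {δ : ℝ} (hδ : 0 < δ) :
    ∀ᶠ ε in 𝓝[>] (0:ℝ), ∀ A ∈ VV W, ∀ k ∈ A, ∀ e ∈ EE W, e ⊆ A →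
      ∀ z ∈ SZ W, 0 ≤ u A z → z k ≤ - δ * u A z → ε ≤ Q e z := by
  simp only [Filter.eventually_all_finset, Filter.eventually_all]
  intro A hA k hk e he heA
  have := cl (κ := Bool) (SZ_compact W) (fun b z => cond b (- u A z) (z k + δ * u A z))
    (fun b => by cases b <;> simp only [cond_true, cond_false] <;> fun_prop)
    (fun z => Q e z) (by fun_prop) (by
      intro z hz hb
      have h1 : 0 ≤ u A z := by
        have := hb true
        simp only [cond_true] at this
        linarith
      have h2 : z k + δ * u A z ≤ 0 := hb false
      refine lt_of_le_of_ne (Q_nonneg _ _) fun h => ?_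
      have hez := Q_eq_zero.1 h.symm
      obtain ⟨v, hv⟩ := VV_vert hA
      obtain ⟨x, hx⟩ := EE_vert he
      obtain ⟨i, j, hij, rfl⟩ := Finset.card_eq_two.1 (EE_card he)
      have hi : i ∈ ({i, j} : Finset ι) := by simp
      have hj : j ∈ ({i, j} : Finset ι) := by simp
      have huv : u A v = 0 := Finset.sum_eq_zero fun i hi => hv.mem.1 hi
      have hux : 0 < u A x := by
        by_contra hcon
        have h3 := u_eq_zero (fun i _ => hx.nonneg i) (not_lt.1 hcon)
        have h4 : A ⊆ {i, j} := fun l hl => hx.mem.2 (h3 l hl)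
        have := Finset.card_le_card h4
        have := VV_card hA
        have := EE_card he
        omega
      have hind : ∀ s t : ℝ, s • v + t • x = 0 → s = 0 ∧ t = 0 := by
        intro s t hst
        have h3 : u A (s • v + t • x) = 0 := by rw [hst]; simp [u]
        rw [u_add, u_smul, u_smul, huv, mul_zero, zero_add] at h3
        have ht : t = 0 := (mul_eq_zero.1 h3).resolve_right hux.ne'
        rw [ht, zero_smul, add_zero] at hst
        exact ⟨(smul_eq_zero.1 hst).resolve_right hv.ne_zero, ht⟩
      obtain ⟨s, t, hst⟩ := H2 W hW.hdim hW.hfac hij hv.memW hx.memW hz.1 hind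
        (hv.mem.1 (heA hi)) (hv.mem.1 (heA hj)) (hx.mem.1 hi) (hx.mem.1 hj) (hez i hi) (hez j hj)
      have huz : u A z = t * u A x := by
        rw [hst, u_add, u_smul, u_smul, huv, mul_zero, zero_add]
      have ht : 0 ≤ t := by
        rw [huz] at h1
        by_contra hcon
        nlinarith
      have hzk : z k = t * x k := by
        rw [hst]; simp [hv.mem.1 hk]
      have hxk := hx.nonneg k
      have hzk0 : 0 ≤ z k := by rw [hzk]; positivity
      have hu0 : u A z = 0 := by nlinarith
      have ht0 : t = 0 := by
        rw [huz] at hu0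
        exact (mul_eq_zero.1 hu0).resolve_right hux.ne'
      rw [ht0, zero_smul, add_zero] at hst
      have h5 := hz.2.1
      rw [hst, phi_smul, hv.phi1, mul_one] at h5
      rw [h5, zero_smul] at hst
      exact SZ_ne hz hst)
  filter_upwards [this, self_mem_nhdsWithin] with ε hε hε0 z hz h1 h2
  have hε0 : 0 < ε := hε0
  refine hε z hz ?_
  rintro (_ | _)
  · simp only [cond_false]; linarith
  · simp only [cond_true]; linarith

end PolyThree


namespace PolyThree

set_option linter.unusedSectionVars false
set_option linter.unusedVariables false

open Filter Topology

variable {ι : Type} [Fintype ι] [DecidableEq ι]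

def SW (W : Submodule ℝ (ι → ℝ)) : Set (ι → ℝ) := {z | z ∈ W ∧ ‖z‖ = 1}

lemma SW_compact (W : Submodule ℝ (ι → ℝ)) : IsCompact (SW W) := by
  apply IsCompact.of_isClosed_subset (isCompact_sphere (0 : ι → ℝ) 1)
  · have h1 : IsClosed (W : Set (ι → ℝ)) := W.closed_of_finiteDimensional
    have h3 : IsClosed {y : ι → ℝ | ‖y‖ = 1} := isClosed_eq continuous_norm continuous_const
    exact h1.inter h3
  · intro y hy
    simpa using hy.2

lemma rr_nonneg (W : Submodule ℝ (ι → ℝ)) (y : ι → ℝ) : 0 ≤ rr W y :=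
  Finset.prod_nonneg fun A _ => Q_nonneg A y
lemma BB_nonneg (W : Submodule ℝ (ι → ℝ)) (y : ι → ℝ) : 0 ≤ BB W y :=
  Finset.prod_nonneg fun A _ => Q_nonneg A y

lemma rr_pos {W : Submodule ℝ (ι → ℝ)} (hW : Hyp W) {y : ι → ℝ} (hy : y ∈ W)
    (hφ : 0 ≤ phi y) {i : ι} (hi : y i < 0 ∨ (y ≠ 0 ∧ phi y = 0)) : 0 < rr W y := by
  refine Finset.prod_pos fun A hA => lt_of_le_of_ne (Q_nonneg _ _) fun h => ?_
  have h0 := Q_eq_zero.1 h.symm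
  obtain ⟨v, hv⟩ := VV_vert hA
  have h1 := H3' hW (VV_card hA) hv.memW hv.phi1 (fun i hi => hv.mem.1 hi) hy h0
  rcases hi with hi | ⟨hi, hi'⟩
  · rw [h1] at hi
    have := hv.nonneg i
    simp only [Pi.smul_apply, smul_eq_mul] at hi
    have : 0 ≤ phi y * v i := by positivity
    linarith
  · rw [hi', zero_smul] at h1
    exact hi h1

lemma exists_neg {y : ι → ℝ} (h0 : y ≠ 0) (hφ : phi y = 0) : ∃ i, y i < 0 := by
  by_contra h
  push Not at h
  have := phi_pos h h0
  linarith

lemma stepA {W : Submodule ℝ (ι → ℝ)} (hW : Hyp W) {ε : ℝ} (hε : 0 < ε) :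
    ∃ N : ℕ, ∀ y ∈ W, y ≠ 0 → 0 ≤ phi y → 0 ≤ p0 W N y → 0 < phi y ∧ ∀ i, - y i ≤ ε * phi y := by
  have hc : ∀ᶠ c in 𝓝[>] (0:ℝ), ∀ i, ∀ y ∈ SW W, 0 ≤ phi y → y i + ε * phi y ≤ 0 →
      c ≤ rr W y := by
    rw [eventually_all]
    intro i
    have := cl (κ := Bool) (SW_compact W) (fun b z => cond b (- phi z) (z i + ε * phi z))
      (fun b => by cases b <;> simp only [cond_true, cond_false] <;> fun_prop)
      (fun z => rr W z) (by fun_prop) (by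
        intro z hz hb
        have h1 : 0 ≤ phi z := by
          have := hb true
          simp only [cond_true] at this
          linarith
        have h2 : z i + ε * phi z ≤ 0 := hb false
        apply rr_pos hW hz.1 h1 (i := i)
        rcases h1.lt_or_eq with h | h
        · left
          have : 0 < ε * phi z := by positivity
          linarith
        · right
          refine ⟨?_, h.symm⟩
          rintro rfl
          have := hz.2
          simp at this)
    filter_upwards [this, self_mem_nhdsWithin] with c hc hc0 z hz h1 h2
    have hc0 : 0 < c := hc0
    refine hc z hz ?_
    rintro (_ | _)
    · simp only [cond_false]; linarith
    · simp only [cond_true]; linarith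
  obtain ⟨c, hc, hc0⟩ := (hc.and self_mem_nhdsWithin).exists
  have hc0 : 0 < c := hc0
  obtain ⟨C, hC⟩ := (SW_compact W).exists_bound_of_continuousOn
    (f := fun y => R W y * phi y ^ (VV W).card) (by fun_prop)
  obtain ⟨N, hN, hN1⟩ := (((tendsto_pow_atTop_atTop_of_one_lt
    (show (1:ℝ) < (1 + ε) ^ 2 by nlinarith)).eventually_gt_atTop
      ((Fintype.card ι : ℝ) * C / c)).and (eventually_ge_atTop 1)).exists
  refine ⟨N, ?_⟩
  have key : ∀ y ∈ SW W, 0 ≤ phi y → ∀ i, y i < 0 → y i + ε * phi y ≤ 0 → p0 W N y < 0 := by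
    intro y hy hφ i hi hi2
    have h1 := hc i y hy hφ hi2
    have h2 := (le_abs_self _).trans (hC y hy)
    set X := (phi y - y i) ^ (2 * N) with hX
    have hXpos : 0 < X := by
      have : 0 < phi y - y i := by linarith
      positivity
    have hXS : X ≤ ∑ i, (phi y - y i) ^ (2 * N) :=
      Finset.single_le_sum (f := fun i => (phi y - y i) ^ (2 * N))
        (fun j _ => by rw [pow_mul]; positivity) (Finset.mem_univ i)
    have h3 : ((1 + ε) ^ 2) ^ N * phi y ^ (2 * N) ≤ X := by
      rw [← pow_mul, ← mul_pow, hX]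
      apply pow_le_pow_left₀ (by positivity)
      linarith
    have h4 : (Fintype.card ι : ℝ) * C < ((1 + ε) ^ 2) ^ N * c := by
      rwa [div_lt_iff₀ hc0] at hN
    have h5 : (Fintype.card ι : ℝ) * C * phi y ^ (2 * N) < c * X := by
      rcases hφ.lt_or_eq with h | h
      · have hp : 0 < phi y ^ (2 * N) := by positivity
        calc _ < ((1 + ε) ^ 2) ^ N * c * phi y ^ (2 * N) := by gcongr
          _ = c * (((1 + ε) ^ 2) ^ N * phi y ^ (2 * N)) := by ring
          _ ≤ c * X := by gcongr
      · rw [← h, zero_pow (by omega), mul_zero]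
        positivity
    have h6 : (Fintype.card ι : ℝ) * (R W y * phi y ^ (VV W).card) * phi y ^ (2 * N)
        ≤ (Fintype.card ι : ℝ) * C * phi y ^ (2 * N) := by gcongr
    have h7 : c * X ≤ rr W y * ∑ i, (phi y - y i) ^ (2 * N) := by
      have := rr_nonneg W y
      gcongr
    unfold p0
    rw [pow_add]
    nlinarith
  intro y hy h0 hφ hp
  have hn : 0 < ‖y‖ := norm_pos_iff.2 h0
  have hy' : ‖y‖⁻¹ • y ∈ SW W := by
    refine ⟨W.smul_mem _ hy, ?_⟩
    rw [norm_smul, norm_inv, norm_norm, inv_mul_cancel₀ hn.ne']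
  have hp' : 0 ≤ p0 W N (‖y‖⁻¹ • y) := by
    rw [p0_smul]; positivity
  have hφ' : 0 ≤ phi (‖y‖⁻¹ • y) := by
    rw [phi_smul]; positivity
  have key2 : ∀ i, y i < 0 → - y i < ε * phi y := by
    intro i hi
    by_contra hcon
    have := key _ hy' hφ' i (by
      simp only [Pi.smul_apply, smul_eq_mul]
      have := inv_pos.2 hn
      nlinarith) (by
      rw [phi_smul]
      simp only [Pi.smul_apply, smul_eq_mul]
      have := inv_pos.2 hn
      nlinarith)
    linarith
  have hpos : 0 < phi y := by
    rcases hφ.lt_or_eq with h | h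
    · exact h
    · obtain ⟨i, hi⟩ := exists_neg h0 h.symm
      have := key2 i hi
      rw [← h] at this
      linarith
  refine ⟨hpos, fun i => ?_⟩
  by_cases hi : y i < 0
  · exact (key2 i hi).le
  · have : 0 < ε * phi y := by positivity
    linarith

lemma stepB {W : Submodule ℝ (ι → ℝ)} (hW : Hyp W) {ε : ℝ} (hε : 0 < ε)
    (hF1 : ∀ A ∈ VV W, ∀ A' ∈ VV W, A ≠ A' → ∀ y ∈ S1 W, (∀ i, -y i ≤ ε) →
      ε ≤ max (u A y) (u A' y)) {N : ℕ} {y : ι → ℝ} (hy : y ∈ S1 W) (hyε : ∀ i, -y i ≤ ε)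
    {i : ι} (hi : y i < 0) (hp : 0 ≤ p0 W N y) : ∀ A ∈ VV W, 0 < u A y := by
  have hr : 0 < rr W y := rr_pos hW hy.1 (by rw [hy.2.1]; norm_num) (Or.inl hi)
  have hS : 0 < ∑ i, (phi y - y i) ^ (2 * N) := by
    apply Finset.sum_pos' (fun j _ => by rw [pow_mul]; positivity)
    refine ⟨i, Finset.mem_univ i, ?_⟩
    rw [hy.2.1]
    have : 0 < 1 - y i := by linarith
    positivity
  have hR : 0 < R W y := by
    unfold p0 at hp
    rw [hy.2.1] at hp hS
    rw [one_pow, mul_one] at hp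
    have h1 : 0 < rr W y * ∑ i, (1 - y i) ^ (2 * N) := by positivity
    have h2 : 0 < (Fintype.card ι : ℝ) * R W y := by linarith
    exact pos_of_mul_pos_right h2 (by positivity)
  intro A hA
  by_contra hcon
  have hcon := not_lt.1 hcon
  unfold R at hR
  rw [← Finset.mul_prod_erase _ _ hA] at hR
  have : 0 < ∏ A' ∈ (VV W).erase A, u A' y := by
    apply Finset.prod_pos
    intro A' hA'
    rw [Finset.mem_erase] at hA'
    rcases le_max_iff.1 (hF1 A hA A' hA'.2 hA'.1.symm y hy hyε) with h | h <;> linarith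
  nlinarith

lemma pair_sum {i j : ι} (hij : i ≠ j) (y : ι → ℝ) : u {i, j} y = y i + y j := by
  unfold u
  exact Finset.sum_pair hij

lemma to_SZ {W : Submodule ℝ (ι → ℝ)} {A : Finset ι} {v y : ι → ℝ} (hv : Vert W A v)
    (hy : y ∈ S1 W) (hne : y ≠ v) :
    ∃ z ∈ SZ W, ∃ n : ℝ, 0 < n ∧ (∀ i ∈ A, y i = n * z i) := by
  have hn : 0 < ‖y - v‖ := norm_pos_iff.2 (sub_ne_zero.2 hne)
  refine ⟨‖y - v‖⁻¹ • (y - v), ⟨W.smul_mem _ (W.sub_mem hy.1 hv.memW), ?_, ?_⟩, ‖y - v‖, hn, ?_⟩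
  · rw [phi_smul, phi_sub, hy.2.1, hv.phi1]; simp
  · rw [norm_smul, norm_inv, norm_norm, inv_mul_cancel₀ hn.ne']
  · intro i hi
    simp only [Pi.smul_apply, smul_eq_mul, Pi.sub_apply, hv.mem.1 hi, sub_zero]
    field_simp

lemma u_scale {A B : Finset ι} (hB : B ⊆ A) {y z : ι → ℝ} {n : ℝ} (h : ∀ i ∈ A, y i = n * z i) :
    u B y = n * u B z := by
  unfold u
  rw [Finset.mul_sum]
  exact Finset.sum_congr rfl fun i hi => h i (hB hi)

lemma Q_scale {A B : Finset ι} (hB : B ⊆ A) {y z : ι → ℝ} {n : ℝ} (h : ∀ i ∈ A, y i = n * z i) :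
    Q B y = n ^ 2 * Q B z := by
  unfold Q
  rw [Finset.mul_sum]
  exact Finset.sum_congr rfl fun i hi => by rw [h i (hB hi), mul_pow]

lemma stepD {W : Submodule ℝ (ι → ℝ)} {κ ε η δ : ℝ} 
    (hκ : 0 < κ) (hεκ : ε < κ) (hη : 0 < η) (hδ : 0 < δ) (hδη : δ * Fintype.card ι ≤ η)
    (hF2 : ∀ A ∈ VV W, ∀ j, j ∉ A → ∀ y ∈ S1 W, (∀ i, -y i ≤ κ) → u A y ≤ κ → κ ≤ y j)
    (hF3 : ∀ A ∈ VV W, ∀ i ∈ A, ∀ j ∈ A, i ≠ j → {i, j} ∉ EE W →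
      ∀ z ∈ SZ W, (∀ k ∈ A, -z k ≤ η) → η ≤ max (z i) (z j))
    (hF4 : ∀ A ∈ VV W, ∀ i ∈ A, ∀ j ∈ A, i ≠ j → ∀ e' ∈ EE W, e' ⊆ A →
      e' ≠ {i, j} → 
      ∀ z ∈ SZ W, (∀ k ∈ A, -z k ≤ η) → η ≤ max (max (z i) (z j)) (u e' z))
    (hF5 : ∀ i j, i ≠ j → {i, j} ∉ EE W → 
      ∀ y ∈ S1 W, (∀ k, -y k ≤ ε) → (∀ A ∈ VV W, κ ≤ u A y) → 0 < max (y i) (y j))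
    (hF6 : ∀ i j, i ≠ j → ∀ e' ∈ EE W, e' ≠ {i, j} → 
      ∀ y ∈ S1 W, (∀ k, -y k ≤ ε) → (∀ A ∈ VV W, κ ≤ u A y) →
        0 < max (max (y i) (y j)) (u e' y))
    {y : ι → ℝ} (hy : y ∈ S1 W) (hyε : ∀ i, -y i ≤ ε) (hu : ∀ A ∈ VV W, 0 < u A y)
    (hcone : ∀ A ∈ VV W, ∀ i ∈ A, - δ * u A y ≤ y i)
    {i j : ι} (hij : i ≠ j) (hi : y i < 0) (hj : y j ≤ 0) :
    {i, j} ∈ EE W ∧ ∀ e' ∈ EE W, e' ≠ {i, j} → 0 < u e' y := by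
  by_cases hV : ∀ A ∈ VV W, κ ≤ u A y
  · constructor
    · by_contra hE
      rcases lt_max_iff.1 (hF5 i j hij hE y hy hyε hV) with h | h <;> linarith
    · intro e' he' hne
      rcases lt_max_iff.1 (hF6 i j hij e' he' hne y hy hyε hV) with h | h
      · rcases lt_max_iff.1 h with h | h <;> linarith
      · exact h
  · push Not at hV
    obtain ⟨A, hA, hAκ⟩ := hV
    have hyκ : ∀ k, k ∉ A → κ ≤ y k := fun k hk =>
      hF2 A hA k hk y hy (fun i => (hyε i).trans hεκ.le) hAκ.le
    have hiA : i ∈ A := by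
      by_contra h
      linarith [hyκ i h]
    have hjA : j ∈ A := by
      by_contra h
      linarith [hyκ j h]
    obtain ⟨v, hv⟩ := VV_vert hA
    have hne : y ≠ v := by
      rintro rfl
      linarith [hv.nonneg i]
    obtain ⟨z, hz, n, hn, hyz⟩ := to_SZ hv hy hne
    have huz := u_scale (le_refl A) hyz
    have hzc : ∀ k ∈ A, -z k ≤ η := by
      intro k hk
      have h1 := hcone A hA k hk
      rw [huz, hyz k hk] at h1
      have h2 : -δ * u A z ≤ z k := by
        by_contra hcon
        nlinarith
      have h3 := (le_abs_self _).trans (SZ_u_le hz A)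
      nlinarith
    have hzi : z i < 0 := by
      rw [hyz i hiA] at hi
      by_contra hcon
      nlinarith
    have hzj : z j ≤ 0 := by
      rw [hyz j hjA] at hj
      by_contra hcon
      nlinarith
    constructor
    · by_contra hE
      rcases le_max_iff.1 (hF3 A hA i hiA j hjA hij hE z hz hzc) with h | h <;> linarith
    · intro e' he' hne'
      by_cases heA : e' ⊆ A
      · have : 0 < u e' z := by
          rcases le_max_iff.1 (hF4 A hA i hiA j hjA hij e' he' heA hne' z hz hzc) with h | h
          · rcases le_max_iff.1 h with h | h <;> linarith
          · linarith
        rw [u_scale heA hyz]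
        positivity
      · obtain ⟨k, hk, hkA⟩ := Finset.not_subset.1 heA
        obtain ⟨a, b, hab, rfl⟩ := Finset.card_eq_two.1 (EE_card he')
        rw [pair_sum hab]
        simp only [Finset.mem_insert, Finset.mem_singleton] at hk
        rcases hk with rfl | rfl
        · linarith [hyκ _ hkA, hyε b]
        · linarith [hyκ _ hkA, hyε a]

end PolyThree


namespace PolyThree

set_option linter.unusedSectionVars false
set_option linter.unusedVariables false

open Filter Topology

variable {ι : Type} [Fintype ι] [DecidableEq ι]

/-- On the cone: `BB ≤ C * UY`. -/
lemma stepK {W : Submodule ℝ (ι → ℝ)} (hW : Hyp W) :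
    ∃ C : ℝ, 0 < C ∧ ∀ y ∈ W, phi y = 1 → (∀ i, 0 ≤ y i) → BB W y ≤ C * UY W y := by
  obtain ⟨c, hc, hc1⟩ := ((F1 hW).and (Ioo_mem_nhdsGT (zero_lt_one))).exists
  have hc0 := hc1.1
  have hc1 := hc1.2
  refine ⟨((c ^ (VV W).card)⁻¹) ^ (EE W).card, by positivity, ?_⟩
  intro y hy hφ hpos
  have hS : y ∈ S1 W := ⟨hy, hφ, fun i => by linarith [hpos i]⟩
  unfold BB UY
  rw [← Finset.prod_const, ← Finset.prod_mul_distrib]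
  apply Finset.prod_le_prod (fun e _ => Q_nonneg e y)
  intro e he
  have hue0 : 0 ≤ u e y := u_nonneg e fun i _ => hpos i
  have hue1 : u e y ≤ 1 := hφ ▸ u_le_phi e hpos
  have h1 : u e y * c ^ (VV W).card ≤ ∏ A ∈ VE W e, u A y := by
    have hcard : (VE W e).card ≤ (VV W).card := Finset.card_le_card (Finset.filter_subset _ _)
    by_cases h : ∃ A ∈ VE W e, u A y < c
    · obtain ⟨A, hA, hAc⟩ := h
      have hA' := Finset.mem_filter.1 hA
      rw [← Finset.mul_prod_erase _ _ hA]
      apply mul_le_mul (u_mono hA'.2 hpos) _ (by positivity) (u_nonneg A fun i _ => hpos i)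
      calc c ^ (VV W).card ≤ c ^ ((VE W e).erase A).card :=
            pow_le_pow_of_le_one hc0.le hc1.le ((Finset.card_erase_le).trans hcard)
        _ = ∏ A' ∈ (VE W e).erase A, c := by simp
        _ ≤ _ := by
          apply Finset.prod_le_prod (fun _ _ => hc0.le)
          intro A' hA''
          rw [Finset.mem_erase] at hA''
          have hA3 := Finset.mem_filter.1 hA''.2
          rcases le_max_iff.1 (hc A hA'.1 A' hA3.1 hA''.1.symm y hS
            (fun i => by linarith [hpos i])) with h | h
          · linarith
          · exact h
    · push Not at h
      calc u e y * c ^ (VV W).card ≤ 1 * c ^ (VE W e).card := by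
            apply mul_le_mul hue1 (pow_le_pow_of_le_one hc0.le hc1.le hcard) (by positivity)
              zero_le_one
        _ = ∏ A' ∈ VE W e, c := by simp
        _ ≤ _ := Finset.prod_le_prod (fun _ _ => hc0.le) h
  have h2 := Q_le_sq e hpos
  have hp : 0 < c ^ (VV W).card := by positivity
  rw [← div_eq_inv_mul, le_div_iff₀ hp]
  calc Q e y * c ^ (VV W).card ≤ u e y ^ 2 * c ^ (VV W).card := by gcongr
    _ = u e y * (u e y * c ^ (VV W).card) := by ring
    _ ≤ _ := by gcongr

lemma p0_nonneg (W : Submodule ℝ (ι → ℝ)) (N : ℕ) {y : ι → ℝ} (hφ : phi y = 1)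
    (hpos : ∀ i, 0 ≤ y i) : 0 ≤ p0 W N y := by
  have hu0 : ∀ A, 0 ≤ u A y := fun A => u_nonneg A fun i _ => hpos i
  have hu1 : ∀ A, u A y ≤ 1 := fun A => hφ ▸ u_le_phi A hpos
  unfold p0
  rw [hφ, one_pow, mul_one]
  have h1 : rr W y ≤ R W y := by
    apply Finset.prod_le_prod (fun A _ => Q_nonneg A y)
    intro A _
    have := Q_le_sq A hpos
    nlinarith [hu0 A, hu1 A]
  have h2 : ∑ i, (1 - y i) ^ (2 * N) ≤ Fintype.card ι := by
    calc ∑ i, (1 - y i) ^ (2 * N) ≤ ∑ i : ι, (1:ℝ) := by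
          apply Finset.sum_le_sum
          intro i _
          have := hφ ▸ le_phi hpos i
          exact pow_le_one₀ (by linarith) (by linarith [hpos i])
      _ = _ := by simp
  have h3 : 0 ≤ ∑ i, (1 - y i) ^ (2 * N) :=
    Finset.sum_nonneg fun i _ => by rw [pow_mul]; positivity
  have h4 := rr_nonneg W y
  nlinarith [mul_le_mul h1 h2 h3 (h4.trans h1)]

lemma p1_nonneg (W : Submodule ℝ (ι → ℝ)) {C : ℝ} (hC0 : 0 ≤ C) (N : ℕ) {y : ι → ℝ}
    (hφ : phi y = 1) (hpos : ∀ i, 0 ≤ y i) (hC : BB W y ≤ C * UY W y) : 0 ≤ p1 W C N y := by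
  have hu0 : ∀ A, 0 ≤ u A y := fun A => u_nonneg A fun i _ => hpos i
  unfold p1
  rw [hφ, one_pow, mul_one, one_pow, mul_one]
  have hR0 : 0 ≤ R W y := Finset.prod_nonneg fun A _ => hu0 A
  have h1 : ∑ A ∈ VV W, ∑ i ∈ A, ((∏ A' ∈ (VV W).erase A, u A' y) * (u A y - y i)) ^ (2 * N) ≤
      JJ W * R W y ^ (2 * N) := by
    unfold JJ
    push_cast
    rw [Finset.sum_mul]
    apply Finset.sum_le_sum
    intro A hA
    rw [← nsmul_eq_mul, ← Finset.sum_const]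
    apply Finset.sum_le_sum
    intro i hi
    have hP : 0 ≤ ∏ A' ∈ (VV W).erase A, u A' y := Finset.prod_nonneg fun A _ => hu0 A
    have hi' : y i ≤ u A y := Finset.single_le_sum (f := y) (fun j _ => hpos j) hi
    have hRe : R W y = (∏ A' ∈ (VV W).erase A, u A' y) * u A y := by
      unfold R
      rw [← Finset.prod_erase_mul _ _ hA]
    apply pow_le_pow_left₀ (mul_nonneg hP (by linarith))
    rw [hRe]
    apply mul_le_mul_of_nonneg_left _ hP
    linarith [hpos i]
  have hB := BB_nonneg W y
  have hRN : 0 ≤ R W y ^ (2 * N) := by positivity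
  have hJ : (0:ℝ) ≤ JJ W := by positivity
  have h2 := mul_le_mul_of_nonneg_left h1 hB
  have h3 : BB W y * (JJ W * R W y ^ (2 * N)) ≤ C * UY W y * (JJ W * R W y ^ (2 * N)) := by gcongr
  have h4 : 0 ≤ C * UY W y * R W y ^ (2 * N) := mul_nonneg (hB.trans hC) hRN
  nlinarith

/-- Comparison in the region outside of the cone neighbourhood. -/
lemma stepC {W : Submodule ℝ (ι → ℝ)} (hW : Hyp W) {κ δ ε : ℝ} (hκ : 0 < κ) (hδ : 0 < δ)
    (hεκ : ε < κ) (hεδ : ε ≤ δ * κ)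
    (hF2 : ∀ A ∈ VV W, ∀ j, j ∉ A → ∀ y ∈ S1 W, (∀ i, -y i ≤ κ) → u A y ≤ κ → κ ≤ y j) :
    ∃ C' : ℝ, 0 ≤ C' ∧ ∀ y ∈ S1 W, (∀ i, -y i ≤ ε) → (∀ A ∈ VV W, 0 < u A y) →
      ∀ A ∈ VV W, ∀ k ∈ A, y k < - δ * u A y → 0 < BB W y ∧ UY W y ≤ C' * BB W y := by
  obtain ⟨c, hc, hc0⟩ := ((F7 hW hδ).and self_mem_nhdsWithin).exists
  have hc0 : 0 < c := hc0
  set m : ℝ := (Fintype.card ι : ℝ) with hm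
  have hm0 : 0 ≤ m := by positivity
  set b : ℝ := m * (m + 1) + 1 with hb
  have hb1 : 1 ≤ b := by nlinarith
  set n := (VV W).card with hn
  set C1 : ℝ := 1 / κ ^ 2 + 1 + m ^ 2 / c with hC1
  have hC1p : 0 ≤ C1 := by positivity
  refine ⟨(C1 * b ^ (n + 1)) ^ (EE W).card, by positivity, ?_⟩
  intro y hy hyε hu A hA k hk hyk
  have huA := hu A hA
  have hAκ : u A y ≤ κ := by
    have := hyε k
    have : δ * u A y ≤ δ * κ := by linarith
    exact le_of_mul_le_mul_left this hδ
  have hyκ : ∀ j, j ∉ A → κ ≤ y j := fun j hj =>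
    hF2 A hA j hj y hy (fun i => (hyε i).trans hεκ.le) hAκ
  have hub : ∀ B, |u B y| ≤ b := by
    intro B
    have := abs_u_le B y (b := m + 1) (fun i => by
      rw [abs_le]
      constructor
      · linarith [hy.2.2 i]
      · linarith [S1_le hy i]) (by linarith)
    linarith
  have hub' : ∀ B, u B y ≤ b := fun B => (le_abs_self _).trans (hub B)
  obtain ⟨v, hv⟩ := VV_vert hA
  have hne : y ≠ v := by
    rintro rfl
    have := hv.nonneg k
    nlinarith
  obtain ⟨z, hz, s, hs, hyz⟩ := to_SZ hv hy hne
  have huz := u_scale (le_refl A) hyz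
  have huz0 : 0 ≤ u A z := by
    rw [huz] at huA
    by_contra hcon
    nlinarith
  have hzk : z k ≤ -δ * u A z := by
    rw [huz, hyz k hk] at hyk
    by_contra hcon
    nlinarith
  have key : ∀ e ∈ EE W, 0 < Q e y ∧
      |u e y * ∏ A ∈ VE W e, u A y| ≤ C1 * b ^ (n + 1) * Q e y := by
    intro e he
    have hprod : ∀ T : Finset (Finset ι), T ⊆ VV W → |∏ A ∈ T, u A y| ≤ b ^ n := by
      intro T hT
      rw [Finset.abs_prod]
      calc ∏ A ∈ T, |u A y| ≤ ∏ A ∈ T, b := Finset.prod_le_prod (fun _ _ => abs_nonneg _)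
            (fun A _ => hub A)
        _ = b ^ T.card := by simp
        _ ≤ b ^ n := pow_le_pow_right₀ hb1 (Finset.card_le_card hT)
    by_cases heA : e ⊆ A
    · have hQz := hc A hA k hk e he heA z hz huz0 hzk
      have hQ := Q_scale heA hyz
      have hQpos : 0 < Q e y := by
        rw [hQ]
        have : 0 < Q e z := by linarith
        positivity
      refine ⟨hQpos, ?_⟩
      have h1 : u A y ^ 2 ≤ m ^ 2 / c * Q e y := by
        rw [hQ, huz]
        have h3 := SZ_u_le hz A
        have h4 : u A z ^ 2 ≤ m ^ 2 := by
          rw [← sq_abs]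
          exact pow_le_pow_left₀ (abs_nonneg _) h3 2
        have h5 : m ^ 2 ≤ m ^ 2 / c * Q e z := by
          rw [div_mul_eq_mul_div, le_div_iff₀ hc0]
          gcongr
        have hs2 : 0 < s ^ 2 := by positivity
        nlinarith
      have h2 : u e y ^ 2 ≤ 2 * Q e y := by
        obtain ⟨i, j, hij, rfl⟩ := Finset.card_eq_two.1 (EE_card he)
        rw [pair_sum hij]
        unfold Q
        rw [Finset.sum_pair hij]
        nlinarith [sq_nonneg (y i - y j)]
      have hAe : A ∈ VE W e := Finset.mem_filter.2 ⟨hA, heA⟩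
      rw [← Finset.mul_prod_erase _ _ hAe, ← mul_assoc, abs_mul]
      have h3 := hprod ((VE W e).erase A)
        ((Finset.erase_subset _ _).trans (Finset.filter_subset _ _))
      have h4 : |u e y * u A y| ≤ C1 * Q e y := by
        have : |u e y * u A y| ≤ (u e y ^ 2 + u A y ^ 2) / 2 := by
          rw [abs_le]
          constructor <;> nlinarith [sq_nonneg (u e y - u A y), sq_nonneg (u e y + u A y)]
        have h6 : 0 ≤ 1 / κ ^ 2 * Q e y := by positivity
        have h7 : 0 ≤ m ^ 2 / c * Q e y := by positivity
        rw [hC1, add_mul, add_mul]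
        linarith
      calc _ ≤ C1 * Q e y * b ^ n := mul_le_mul h4 h3 (abs_nonneg _) (by positivity)
        _ ≤ C1 * Q e y * b ^ (n + 1) := by
          gcongr
          omega
        _ = _ := by ring
    · obtain ⟨j, hj, hjA⟩ := Finset.not_subset.1 heA
      have h1 := hyκ j hjA
      have h2 : κ ^ 2 ≤ Q e y := by
        calc κ ^ 2 ≤ y j ^ 2 := by gcongr
          _ ≤ Q e y := Finset.single_le_sum (f := fun i => y i ^ 2) (fun i _ => sq_nonneg _) hj
      have hQpos : 0 < Q e y := lt_of_lt_of_le (by positivity) h2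
      refine ⟨hQpos, ?_⟩
      rw [abs_mul]
      have h3 := hprod (VE W e) (Finset.filter_subset _ _)
      have h4 : 1 ≤ C1 * Q e y := by
        have h5 : 1 ≤ 1 / κ ^ 2 * Q e y := by
          rw [div_mul_eq_mul_div, le_div_iff₀ (by positivity)]
          linarith
        have h7 : 0 ≤ m ^ 2 / c * Q e y := by positivity
        rw [hC1, add_mul, add_mul]
        linarith
      calc _ ≤ b * b ^ n := mul_le_mul (hub e) h3 (abs_nonneg _) (by linarith)
        _ = 1 * b ^ (n + 1) := by ring
        _ ≤ C1 * Q e y * b ^ (n + 1) := by gcongr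
        _ = _ := by ring
  refine ⟨Finset.prod_pos fun e he => (key e he).1, ?_⟩
  refine (le_abs_self _).trans ?_
  unfold UY BB
  rw [Finset.abs_prod, ← Finset.prod_const, ← Finset.prod_mul_distrib]
  exact Finset.prod_le_prod (fun _ _ => abs_nonneg _) fun e he => (key e he).2

theorem main {W : Submodule ℝ (ι → ℝ)} (hW : Hyp W) :
    ∃ (N₀ N₁ : ℕ) (C : ℝ), ∀ y ∈ W, y ≠ 0 →
      ((0 ≤ p0 W N₀ y ∧ 0 ≤ p1 W C N₁ y ∧ 0 ≤ p2 y) ↔ ((∀ i, 0 ≤ y i) ∨ (∀ i, 0 ≤ (-y) i))) := by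
  obtain ⟨C, hC0, hC⟩ := stepK hW
  obtain ⟨κ, hF2, hκ⟩ := ((F2 hW).and self_mem_nhdsWithin).exists
  have hκ : 0 < κ := hκ
  obtain ⟨η, ⟨hF3, hF4⟩, hη⟩ := (((F3 hW).and (F4 hW)).and self_mem_nhdsWithin).exists
  have hη : 0 < η := hη
  set δ : ℝ := η / (Fintype.card ι + 1) with hδd
  have hδ : 0 < δ := by positivity
  have hδη : δ * Fintype.card ι ≤ η := by
    have : δ * (Fintype.card ι + 1) = η := by rw [hδd]; field_simp
    linarith
  have hmin : 0 < min (min κ (δ * κ)) 1 := by positivity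
  obtain ⟨ε, ⟨hF1, hF5, hF6⟩, hε0, hε⟩ := (((F1 hW).and ((F5 (W := W) hκ).and (F6 (W := W) hκ))).and
    (Ioo_mem_nhdsGT hmin)).exists
  simp only [lt_min_iff] at hε
  obtain ⟨⟨hε1, hε2⟩, hε3⟩ := hε
  obtain ⟨C', hC'0, hC'⟩ := stepC hW hκ hδ hε1 hε2.le hF2
  obtain ⟨N₁, hN₁⟩ := ((tendsto_pow_atTop_atTop_of_one_lt
    (show (1:ℝ) < (1 + δ) ^ 2 by nlinarith)).eventually_gt_atTop
      (((JJ W : ℝ) + 1) * C * C')).exists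
  obtain ⟨N₀, hN₀⟩ := stepA hW hε0
  refine ⟨N₀, N₁, C, ?_⟩
  -- the nonnegative direction
  have fwd : ∀ y ∈ W, y ≠ 0 → (∀ i, 0 ≤ y i) →
      0 ≤ p0 W N₀ y ∧ 0 ≤ p1 W C N₁ y ∧ 0 ≤ p2 y := by
    intro y hy h0 hpos
    have hφ := phi_pos hpos h0
    have hy1 : phi ((phi y)⁻¹ • y) = 1 := by rw [phi_smul, inv_mul_cancel₀ hφ.ne']
    have hpos1 : ∀ i, 0 ≤ ((phi y)⁻¹ • y) i := fun i => by
      have := hpos i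
      simp only [Pi.smul_apply, smul_eq_mul]
      positivity
    have hyy : y = phi y • ((phi y)⁻¹ • y) := by
      rw [smul_smul, mul_inv_cancel₀ hφ.ne', one_smul]
    refine ⟨?_, ?_, ?_⟩
    · rw [hyy, p0_smul]
      exact mul_nonneg (by positivity) (p0_nonneg W N₀ hy1 hpos1)
    · rw [hyy, p1_smul]
      exact mul_nonneg (by positivity)
        (p1_nonneg W hC0.le N₁ hy1 hpos1 (hC _ (W.smul_mem _ hy) hy1 hpos1))
    · exact mul_nonneg (Finset.prod_nonneg fun i _ => hpos i) (by positivity)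
  -- the core direction
  have bwd : ∀ y ∈ W, y ≠ 0 → 0 ≤ phi y →
      (0 ≤ p0 W N₀ y ∧ 0 ≤ p1 W C N₁ y ∧ 0 ≤ p2 y) → ∀ i, 0 ≤ y i := by
    intro y hy h0 hφ0 ⟨hp0, hp1, hp2⟩
    obtain ⟨hφ, hyε⟩ := hN₀ y hy h0 hφ0 hp0
    set x := (phi y)⁻¹ • y with hx
    have hxW : x ∈ W := W.smul_mem _ hy
    have hx1 : phi x = 1 := by rw [hx, phi_smul, inv_mul_cancel₀ hφ.ne']
    have hxi : ∀ i, x i = (phi y)⁻¹ * y i := fun i => rfl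
    have hinv : 0 < (phi y)⁻¹ := inv_pos.2 hφ
    have hxε : ∀ i, -x i ≤ ε := by
      intro i
      have h1 := hyε i
      rw [hxi, neg_mul_eq_mul_neg, ← div_eq_inv_mul, div_le_iff₀ hφ]
      exact h1
    have hxS : x ∈ S1 W := ⟨hxW, hx1, fun i => by linarith [hxε i]⟩
    have hq0 : 0 ≤ p0 W N₀ x := by
      rw [hx, p0_smul]; positivity
    have hq1 : 0 ≤ p1 W C N₁ x := by
      rw [hx, p1_smul]; positivity
    have hq2 : 0 ≤ p2 x := by
      rw [hx, p2_smul]; positivity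
    clear_value x
    by_contra hcon
    push Not at hcon
    obtain ⟨i, hi⟩ := hcon
    have hxineg : x i < 0 := by
      rw [hxi]; nlinarith
    have hu := stepB hW hε0 hF1 hxS hxε hxineg hq0
    have hR : 0 < R W x := Finset.prod_pos hu
    unfold p1 at hq1
    rw [hx1, one_pow, mul_one, one_pow, mul_one] at hq1
    have hcone : ∀ A ∈ VV W, ∀ k ∈ A, - δ * u A x ≤ x k := by
      intro A hA k hk
      by_contra hlt
      have hlt := not_le.1 hlt
      obtain ⟨hB, hUB⟩ := hC' x hxS hxε hu A hA k hk hlt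
      have huA := hu A hA
      set T := ∏ A' ∈ (VV W).erase A, u A' x with hT
      have hTpos : 0 < T := Finset.prod_pos fun A' hA' => hu A' (Finset.mem_of_mem_erase hA')
      have hRe : R W x = T * u A x := by
        unfold R
        rw [hT, Finset.prod_erase_mul _ _ hA]
      have h1 : ((1 + δ) ^ 2) ^ N₁ * R W x ^ (2 * N₁) ≤ (T * (u A x - x k)) ^ (2 * N₁) := by
        rw [← pow_mul, ← mul_pow]
        apply pow_le_pow_left₀ (by positivity)
        rw [hRe]
        nlinarith
      have h2 : (T * (u A x - x k)) ^ (2 * N₁) ≤ ∑ A ∈ VV W, ∑ i ∈ A,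
          ((∏ A' ∈ (VV W).erase A, u A' x) * (u A x - x i)) ^ (2 * N₁) := by
        have hnn : ∀ A : Finset ι, ∀ i, 0 ≤
          ((∏ A' ∈ (VV W).erase A, u A' x) * (u A x - x i)) ^ (2 * N₁) := fun A i => by
            rw [pow_mul]; positivity
        refine le_trans ?_ (Finset.single_le_sum (f := fun A => ∑ i ∈ A,
          ((∏ A' ∈ (VV W).erase A, u A' x) * (u A x - x i)) ^ (2 * N₁))
          (fun A _ => Finset.sum_nonneg fun i _ => hnn A i) hA)
        exact Finset.single_le_sum (f := fun i =>
          ((∏ A' ∈ (VV W).erase A, u A' x) * (u A x - x i)) ^ (2 * N₁)) (fun i _ => hnn A i) hk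
      have hRN : 0 < R W x ^ (2 * N₁) := by positivity
      have h3 := mul_le_mul_of_nonneg_left (h1.trans h2) hB.le
      have h4 : ((JJ W : ℝ) + 1) * C * UY W x * R W x ^ (2 * N₁) ≤
          ((JJ W : ℝ) + 1) * C * (C' * BB W x) * R W x ^ (2 * N₁) := by gcongr
      have h5 : ((JJ W : ℝ) + 1) * C * C' * (BB W x * R W x ^ (2 * N₁)) <
        ((1 + δ) ^ 2) ^ N₁ * (BB W x * R W x ^ (2 * N₁)) := by gcongr
      nlinarith
    obtain ⟨j, hji, hj⟩ : ∃ j, j ≠ i ∧ x j ≤ 0 := by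
      by_contra hno
      push Not at hno
      unfold p2 at hq2
      rw [hx1, one_pow, mul_one, ← Finset.mul_prod_erase _ _ (Finset.mem_univ i)] at hq2
      have : 0 < ∏ j ∈ Finset.univ.erase i, x j :=
        Finset.prod_pos fun j hj => hno j (Finset.ne_of_mem_erase hj)
      nlinarith
    obtain ⟨hE, hE'⟩ := stepD hκ hε1 hη hδ hδη hF2 hF3 hF4 hF5 hF6 hxS hxε hu hcone
      hji.symm hxineg hj
    have hUY : UY W x < 0 := by
      unfold UY
      rw [← Finset.mul_prod_erase _ _ hE]
      have hv : ∀ e, 0 < ∏ A ∈ VE W e, u A x := fun e =>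
        Finset.prod_pos fun A hA => hu A (Finset.mem_filter.1 hA).1
      have h1 : 0 < ∏ e ∈ (EE W).erase {i, j}, (u e x * ∏ A ∈ VE W e, u A x) :=
        Finset.prod_pos fun e he => mul_pos
          (hE' e (Finset.mem_of_mem_erase he) (Finset.ne_of_mem_erase he)) (hv e)
      have h2 : u {i, j} x < 0 := by
        rw [pair_sum hji.symm]; linarith
      exact mul_neg_of_neg_of_pos (mul_neg_of_neg_of_pos h2 (hv _)) h1
    have hRN : 0 < R W x ^ (2 * N₁) := by positivity
    have hJC : 0 < ((JJ W : ℝ) + 1) * C := by positivity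
    have hfirst : ((JJ W : ℝ) + 1) * C * UY W x * R W x ^ (2 * N₁) < 0 :=
      mul_neg_of_neg_of_pos (mul_neg_of_pos_of_neg hJC hUY) hRN
    have hsecond : 0 ≤ BB W x * ∑ A ∈ VV W, ∑ i ∈ A,
        ((∏ A' ∈ (VV W).erase A, u A' x) * (u A x - x i)) ^ (2 * N₁) :=
      mul_nonneg (BB_nonneg W x) (Finset.sum_nonneg fun A _ => Finset.sum_nonneg fun i _ => by
        rw [pow_mul]; positivity)
    linarith
  intro y hy h0
  constructor
  · intro h
    rcases le_total 0 (phi y) with hφ | hφ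
    · exact Or.inl (bwd y hy h0 hφ h)
    · right
      have hneg : -y = (-1 : ℝ) • y := by simp
      refine bwd (-y) (W.neg_mem hy) (neg_ne_zero.2 h0) ?_ ?_
      · rw [hneg, phi_smul]; linarith
      · rw [hneg, p0_smul, p1_smul, p2_smul]
        simpa [pow_mul] using h
  · rintro (h | h)
    · exact fwd y hy h0 h
    · have hneg : -y = (-1 : ℝ) • y := by simp
      have := fwd (-y) (W.neg_mem hy) (neg_ne_zero.2 h0) h
      rw [hneg, p0_smul, p1_smul, p2_smul] at this
      simpa [pow_mul] using this

end PolyThree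


namespace PolyThree

set_option linter.unusedSectionVars false
set_option linter.unusedVariables false

open Filter Topology

variable {ι : Type} [Fintype ι] [DecidableEq ι]

/-- Polynomial functions. -/
def PF (f : E 3 → ℝ) : Prop := ∃ p : MvPolynomial (Fin 3) ℝ, ∀ x, evalPoly p x = f x

lemma PF.const (c : ℝ) : PF (fun _ => c) := ⟨MvPolynomial.C c, fun x => by simp [evalPoly]⟩
lemma PF.coord (i : Fin 3) : PF (fun x => x i) := ⟨MvPolynomial.X i, fun x => by simp [evalPoly]⟩
lemma PF.add {f g : E 3 → ℝ} (hf : PF f) (hg : PF g) : PF (fun x => f x + g x) := by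
  obtain ⟨p, hp⟩ := hf
  obtain ⟨q, hq⟩ := hg
  exact ⟨p + q, fun x => by simp only [← hp, ← hq]; simp [evalPoly]⟩
lemma PF.sub {f g : E 3 → ℝ} (hf : PF f) (hg : PF g) : PF (fun x => f x - g x) := by
  obtain ⟨p, hp⟩ := hf
  obtain ⟨q, hq⟩ := hg
  exact ⟨p - q, fun x => by simp only [← hp, ← hq]; simp [evalPoly]⟩
lemma PF.mul {f g : E 3 → ℝ} (hf : PF f) (hg : PF g) : PF (fun x => f x * g x) := by
  obtain ⟨p, hp⟩ := hf
  obtain ⟨q, hq⟩ := hg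
  exact ⟨p * q, fun x => by simp only [← hp, ← hq]; simp [evalPoly]⟩
lemma PF.pow {f : E 3 → ℝ} (hf : PF f) (n : ℕ) : PF (fun x => f x ^ n) := by
  obtain ⟨p, hp⟩ := hf
  exact ⟨p ^ n, fun x => by simp only [← hp]; simp [evalPoly]⟩
lemma PF.sum {κ : Type} (s : Finset κ) {f : κ → E 3 → ℝ} (hf : ∀ k, PF (f k)) :
    PF (fun x => ∑ k ∈ s, f k x) := by
  choose p hp using hf
  exact ⟨∑ k ∈ s, p k, fun x => by simp only [← hp]; simp [evalPoly]⟩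
lemma PF.prod {κ : Type} (s : Finset κ) {f : κ → E 3 → ℝ} (hf : ∀ k, PF (f k)) :
    PF (fun x => ∏ k ∈ s, f k x) := by
  choose p hp using hf
  exact ⟨∏ k ∈ s, p k, fun x => by simp only [← hp]; simp [evalPoly]⟩

lemma PF.aff (b : ℝ) (a : E 3) : PF (fun x => b - ⟪a, x⟫) := by
  have : (fun x : E 3 => b - ⟪a, x⟫) = fun x => b - ∑ i, a i * x i := by
    funext x
    rw [PiLp.inner_apply]
    simp [mul_comm]
  rw [this]
  exact (PF.const b).sub (PF.sum _ fun i => (PF.const _).mul (PF.coord i))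

lemma PF.u {y : E 3 → ι → ℝ} (hy : ∀ i, PF (fun x => y x i)) (A : Finset ι) :
    PF (fun x => PolyThree.u A (y x)) := PF.sum _ hy
lemma PF.phi {y : E 3 → ι → ℝ} (hy : ∀ i, PF (fun x => y x i)) :
    PF (fun x => PolyThree.phi (y x)) := PF.sum _ hy
lemma PF.Q {y : E 3 → ι → ℝ} (hy : ∀ i, PF (fun x => y x i)) (A : Finset ι) :
    PF (fun x => PolyThree.Q A (y x)) := PF.sum _ fun i => (hy i).pow 2

lemma PF.p0 {y : E 3 → ι → ℝ} (hy : ∀ i, PF (fun x => y x i)) (W : Submodule ℝ (ι → ℝ)) (N : ℕ) :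
    PF (fun x => PolyThree.p0 W N (y x)) := by
  unfold PolyThree.p0
  exact (((PF.const _).mul (PF.prod _ (PF.u hy))).mul ((PF.phi hy).pow _)).sub
    ((PF.prod _ (PF.Q hy)).mul (PF.sum _ fun i => ((PF.phi hy).sub (hy i)).pow _))

lemma PF.p1 {y : E 3 → ι → ℝ} (hy : ∀ i, PF (fun x => y x i)) (W : Submodule ℝ (ι → ℝ)) (C : ℝ)
    (N : ℕ) : PF (fun x => PolyThree.p1 W C N (y x)) := by
  unfold PolyThree.p1
  exact ((((PF.const _).mul (PF.prod _ fun e => (PF.u hy e).mul (PF.prod _ (PF.u hy)))).mul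
    ((PF.phi hy).pow _)).mul ((PF.prod _ (PF.u hy)).pow _)).sub
    (((PF.prod _ (PF.Q hy)).mul ((PF.phi hy).pow _)).mul
      (PF.sum _ fun A => PF.sum _ fun i =>
        ((PF.prod _ (PF.u hy)).mul ((PF.u hy A).sub (hy i))).pow _))

lemma PF.p2 {y : E 3 → ι → ℝ} (hy : ∀ i, PF (fun x => y x i)) :
    PF (fun x => PolyThree.p2 (y x)) := by
  unfold PolyThree.p2
  exact (PF.prod _ hy).mul ((PF.phi hy).pow _)

/-- The homogenized functionals. -/
def LL {m : ℕ} (a : Fin m → E 3) (b : Fin m → ℝ) : Option (Fin m) → (E 3 × ℝ) →ₗ[ℝ] ℝ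
  | none => LinearMap.snd ℝ (E 3) ℝ
  | some k => b k • LinearMap.snd ℝ (E 3) ℝ -
      (innerₛₗ ℝ (a k)).comp (LinearMap.fst ℝ (E 3) ℝ)

lemma LL_none {m : ℕ} (a : Fin m → E 3) (b : Fin m → ℝ) (p : E 3 × ℝ) :
    LL a b none p = p.2 := rfl
lemma LL_some {m : ℕ} (a : Fin m → E 3) (b : Fin m → ℝ) (k : Fin m) (p : E 3 × ℝ) :
    LL a b (some k) p = b k * p.2 - ⟪a k, p.1⟫ := rfl

lemma exists_minimal {m : ℕ} (a : Fin m → E 3) (b : Fin m → ℝ) :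
    ∃ s : Finset (Option (Fin m)), (∀ p, (∀ i ∈ s, 0 ≤ LL a b i p) → ∀ i, 0 ≤ LL a b i p) ∧
      ∀ i ∈ s, ∃ q, LL a b i q < 0 ∧ ∀ j ∈ s, j ≠ i → 0 ≤ LL a b j q := by
  classical
  let T : Finset (Finset (Option (Fin m))) := Finset.univ.filter fun s =>
    ∀ p, (∀ i ∈ s, 0 ≤ LL a b i p) → ∀ i, 0 ≤ LL a b i p
  have hT : T.Nonempty := ⟨Finset.univ, by
    simp only [T, Finset.mem_filter, Finset.mem_univ, true_and]
    exact fun p h i => h i trivial⟩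
  obtain ⟨s, hs, hmin⟩ := T.exists_min_image Finset.card hT
  have hs' := (Finset.mem_filter.1 hs).2
  refine ⟨s, hs', fun i hi => ?_⟩
  by_contra hcon
  push Not at hcon
  have : s.erase i ∈ T := by
    refine Finset.mem_filter.2 ⟨Finset.mem_univ _, fun p hp => hs' p fun j hj => ?_⟩
    by_cases hji : j = i
    · subst hji
      by_contra hlt
      obtain ⟨k, hk, hkj, hk'⟩ := hcon p (not_le.1 hlt)
      have := hp k (Finset.mem_erase.2 ⟨hkj, hk⟩)
      linarith
    · exact hp j (Finset.mem_erase.2 ⟨hji, hj⟩)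
  have h1 := hmin _ this
  have h2 := Finset.card_erase_lt_of_mem hi
  omega

lemma interior_of_dim {P : Set (E 3)} (hne : P.Nonempty) (hconv : Convex ℝ P) (hdim : dimS P = 3) :
    (interior P).Nonempty := by
  rw [hconv.interior_nonempty_iff_affineSpan_eq_top]
  have h : (affineSpan ℝ P).direction = ⊤ := by
    apply Submodule.eq_top_of_finrank_eq
    unfold dimS at hdim
    rw [hdim]; simp
  exact (AffineSubspace.direction_eq_top_iff_of_nonempty
    ((affineSpan_nonempty ℝ).2 hne)).1 h

theorem reduction (P : Set (E 3)) (hP : IsPolyhedron P) (hdim : dimS P = 3) :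
    ∃ p₀ p₁ p₂ : MvPolynomial (Fin 3) ℝ,
      P = {x : E 3 | 0 ≤ evalPoly p₀ x ∧ 0 ≤ evalPoly p₁ x ∧ 0 ≤ evalPoly p₂ x} := by
  classical
  obtain ⟨hne, m, a, b, hPe⟩ := hP
  have hmem : ∀ x, x ∈ P ↔ ∀ i, 0 ≤ LL a b i (x, 1) := by
    intro x
    rw [hPe]
    constructor
    · intro h i
      cases i with
      | none => rw [LL_none]; norm_num
      | some k =>
        rw [LL_some]
        have := h k
        simp only [mul_one]; linarith
    · intro h k
      have := h (some k)
      rw [LL_some] at this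
      simp only [mul_one] at this; linarith
  have hconv : Convex ℝ P := by
    rw [hPe, Set.ofPred_forall]
    exact convex_iInter fun k => convex_halfSpace_le (innerₛₗ ℝ (a k)).isLinear _
  obtain ⟨x0, hx0⟩ := interior_of_dim hne hconv hdim
  obtain ⟨s, hs, hmin⟩ := exists_minimal a b
  have hx0P := (hmem x0).1 (interior_subset hx0)
  have hpos : ∀ i ∈ s, 0 < LL a b i (x0, 1) := by
    intro i hi
    refine lt_of_le_of_ne (hx0P i) fun h0 => ?_
    cases i with
    | none => rw [LL_none] at h0; norm_num at h0
    | some k =>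
      obtain ⟨q, hq, -⟩ := hmin _ hi
      have hnh : ∀ᶠ t : ℝ in 𝓝 0, x0 + t • a k ∈ P := by
        have hcont : Tendsto (fun t : ℝ => x0 + t • a k) (𝓝 0) (𝓝 x0) := by
          have : Continuous (fun t : ℝ => x0 + t • a k) := by fun_prop
          simpa using this.tendsto 0
        exact hcont (mem_interior_iff_mem_nhds.1 hx0)
      obtain ⟨t, ht, ht0⟩ := ((hnh.filter_mono nhdsWithin_le_nhds).and
        (self_mem_nhdsWithin (s := Set.Ioi (0:ℝ)))).exists
      have ht0 : 0 < t := ht0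
      have h1 := (hmem _).1 ht (some k)
      rw [LL_some] at h0 h1
      simp only [mul_one, inner_add_right, inner_smul_right] at h0 h1
      have h2 : ⟪a k, a k⟫ ≤ 0 := by
        by_contra hc
        nlinarith [not_le.1 hc]
      have ha : a k = 0 := by
        rw [real_inner_self_eq_norm_sq] at h2
        have h3 : ‖a k‖ ^ 2 = 0 := le_antisymm h2 (by positivity)
        simpa using h3
      rw [LL_some, ha] at hq
      rw [ha] at h0
      simp only [inner_zero_left, sub_zero] at h0 hq
      rw [← h0] at hq
      simp at hq
  let Λ : (E 3 × ℝ) →ₗ[ℝ] ({i // i ∈ s} → ℝ) := LinearMap.pi fun i => LL a b i.1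
  have hΛ : ∀ p i, Λ p i = LL a b i.1 p := fun p i => rfl
  have hyp : Hyp (LinearMap.range Λ) := by
    refine ⟨?_, ?_⟩
    · refine (LinearMap.finrank_range_le Λ).trans ?_
      simp
    · rintro ⟨i, hi⟩
      obtain ⟨q, hq, hq'⟩ := hmin i hi
      refine ⟨_, ⟨(LL a b i (x0, 1)) • q - (LL a b i q) • (x0, 1), rfl⟩, ?_, ?_⟩
      · rw [hΛ]
        simp only [map_sub, map_smul, smul_eq_mul]
        ring
      · rintro ⟨j, hj⟩ hji
        have hji' : j ≠ i := fun h => hji (Subtype.ext h)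
        rw [hΛ]
        rw [map_sub, map_smul, map_smul, smul_eq_mul, smul_eq_mul]
        have h1 := hpos i hi
        have h2 := hpos j hj
        have h3 := hq' j hj hji'
        nlinarith [mul_nonneg h1.le h3, mul_pos (neg_pos.2 hq) h2]
  obtain ⟨N₀, N₁, C, hmain⟩ := main hyp
  have hcoord : ∀ i, PF (fun x => Λ (x, 1) i) := by
    rintro ⟨i, hi⟩
    cases i with
    | none => exact PF.const 1
    | some k =>
      have := PF.aff (b k) (a k)
      have he : (fun x => Λ (x, 1) ⟨some k, hi⟩) = fun x => b k - ⟪a k, x⟫ := by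
        funext x
        rw [hΛ, LL_some]
        simp
      rw [he]
      exact this
  obtain ⟨q0, hq0⟩ := PF.p0 hcoord (LinearMap.range Λ) N₀
  obtain ⟨q1, hq1⟩ := PF.p1 hcoord (LinearMap.range Λ) C N₁
  obtain ⟨q2, hq2⟩ := PF.p2 hcoord
  refine ⟨q0, q1, q2, ?_⟩
  ext x
  have hnot : ¬ ∀ i, 0 ≤ (-Λ (x, 1)) i := by
    intro h
    have := hs (-(x, 1)) (fun i hi => by
      have := h ⟨i, hi⟩
      rw [← map_neg, hΛ] at this
      exact this) none
    rw [LL_none] at this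
    norm_num at this
  have hy0 : Λ (x, 1) ≠ 0 := by
    intro h
    apply hnot
    rw [h]; simp
  rw [Set.mem_ofPred_eq, hq0, hq1, hq2, hmain _ ⟨_, rfl⟩ hy0, or_iff_left hnot, hmem]
  exact ⟨fun h i => h i.1, fun h => hs _ fun i hi => h ⟨i, hi⟩⟩

end PolyThree

/-- Every 3-dimensional polyhedron in ℝ³ is the solution set of three
polynomial inequalities. -/
theorem polyhedron_three_dim_three_polynomials
    (P : Set (E 3)) (hP : IsPolyhedron P) (hdim : dimS P = 3) :
    ∃ p₀ p₁ p₂ : MvPolynomial (Fin 3) ℝ,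
      P = {x : E 3 | 0 ≤ evalPoly p₀ x ∧ 0 ≤ evalPoly p₁ x ∧ 0 ≤ evalPoly p₂ x} := by
  exact PolyThree.reduction P hP hdim
end
end

section
/- Let P be a 2-dimensional polytope (convex polygon) in ℝ², let p₀ ∈ ℝ[x₁,x₂] be a polynomial whose associated function on ℝ² is strictly concave and which vanishes at each vertex of P, and let p₁(x) := ∏_{I edge of P} q_I(P,x). Then P = {x ∈ ℝ² : p₀(x) ≥ 0 and p₁(x) ≥ 0}. -/
open scoped RealInnerProductSpace Pointwise
open Metric Set

noncomputable section

lemma exists_vertices {P : Set (E 2)} (hP : IsPolytope P) :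
    ∃ V : Finset (E 2), P = convexHull ℝ (V : Set (E 2)) ∧ ∀ v ∈ V, IsVertexOf P v := by
  classical
  obtain ⟨V0, -, hV0⟩ := hP
  have hex : ∃ n : ℕ, ∃ V : Finset (E 2), V.card = n ∧ P = convexHull ℝ (V : Set (E 2)) :=
    ⟨_, V0, rfl, hV0⟩
  obtain ⟨V, hVc, hV⟩ := Nat.find_spec hex
  refine ⟨V, hV, fun v hv => ?_⟩
  have hVe : (V : Set (E 2)) = insert v ((V.erase v : Finset (E 2)) : Set (E 2)) := by
    rw [← Finset.coe_insert, Finset.insert_erase hv]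
  have hnot : v ∉ convexHull ℝ ((V.erase v : Finset (E 2)) : Set (E 2)) := by
    intro hmem
    have h1 : P = convexHull ℝ ((V.erase v : Finset (E 2)) : Set (E 2)) := by
      rw [hV, hVe]
      apply subset_antisymm
      · apply convexHull_min _ (convex_convexHull ℝ _)
        exact insert_subset hmem (subset_convexHull ℝ _)
      · exact convexHull_mono (subset_insert _ _)
    have := Nat.find_min' hex ⟨V.erase v, rfl, h1⟩
    have h2 := Finset.card_erase_lt_of_mem hv
    omega
  obtain ⟨f, c, hf1, hf2⟩ := geometric_hahn_banach_point_closed (convex_convexHull ℝ _)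
    ((V.erase v).finite_toSet.isClosed_convexHull ℝ) hnot
  have hvP : v ∈ P := by rw [hV]; exact subset_convexHull ℝ _ hv
  have key : ∀ x ∈ P, f v ≤ f x ∧ (f x ≤ f v → x = v) := by
    intro x hx
    rcases (V.erase v).eq_empty_or_nonempty with he | hne
    · rw [hV, hVe, he] at hx
      simp at hx
      simp [hx]
    · rw [hV, hVe, convexHull_insert (by exact_mod_cast hne)] at hx
      simp only [mem_convexJoin, mem_singleton_iff, exists_eq_left] at hx
      obtain ⟨b, hb, α, β, hα, hβ, hαβ, rfl⟩ := hx
      have hb' := hf2 b hb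
      have e : f (α • v + β • b) = f v + β * (f b - f v) := by
        simp only [map_add, map_smul, smul_eq_mul]
        obtain rfl : α = 1 - β := by linarith
        ring
      rw [e]
      have hpos : 0 < f b - f v := by linarith
      refine ⟨by nlinarith [mul_nonneg hβ hpos.le], fun h => ?_⟩
      have : β = 0 := by
        by_contra hne
        have : 0 < β := lt_of_le_of_ne hβ (Ne.symm hne)
        nlinarith [mul_pos this hpos]
      obtain rfl : α = 1 := by linarith
      simp [this]
  intro _
  refine ⟨-f, ?_⟩
  ext x
  simp only [mem_singleton_iff, mem_ofPred_eq, neg_apply, neg_le_neg_iff]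
  constructor
  · rintro rfl
    exact ⟨hvP, fun y hy => (key y hy).1⟩
  · rintro ⟨hx, h⟩
    exact (key x hx).2 (h v hvP)

lemma perp_prop {a b c : E 2} (ha : a ≠ 0) (hb : b ≠ 0) (hab : ⟪a, b⟫ = 0) (hac : ⟪a, c⟫ = 0) :
    ∃ k : ℝ, c = k • b := by
  have hbb : b 0 * b 0 + b 1 * b 1 ≠ 0 := by
    intro h
    apply hb
    ext i
    fin_cases i
    · simp; nlinarith [mul_self_nonneg (b 0), mul_self_nonneg (b 1)]
    · simp; nlinarith [mul_self_nonneg (b 0), mul_self_nonneg (b 1)]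
  simp only [PiLp.inner_apply, Fin.sum_univ_two, RCLike.inner_apply, conj_trivial] at hab hac
  have hdet : b 0 * c 1 - b 1 * c 0 = 0 := by
    by_contra hd
    apply ha
    have h0 : a 0 * (b 0 * c 1 - b 1 * c 0) = 0 := by linear_combination c 1 * hab - b 1 * hac
    have h1 : a 1 * (b 0 * c 1 - b 1 * c 0) = 0 := by linear_combination b 0 * hac - c 0 * hab
    ext i
    fin_cases i
    · simpa using (mul_eq_zero.1 h0).resolve_right hd
    · simpa using (mul_eq_zero.1 h1).resolve_right hd
  refine ⟨(b 0 * c 0 + b 1 * c 1) / (b 0 * b 0 + b 1 * b 1), ?_⟩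
  ext i
  fin_cases i
  · simp only [Fin.zero_eta, PiLp.smul_apply, smul_eq_mul]
    rw [div_mul_eq_mul_div, eq_div_iff hbb]
    linear_combination (-b 1) * hdet
  · simp only [Fin.mk_one, PiLp.smul_apply, smul_eq_mul]
    rw [div_mul_eq_mul_div, eq_div_iff hbb]
    linear_combination (b 0) * hdet

lemma le_suppF {P : Set (E 2)} (hP : IsCompact P) (u : E 2) {x : E 2} (hx : x ∈ P) :
    ⟪u, x⟫ ≤ suppF P u := by
  apply le_csSup
  · exact (hP.image (by fun_prop)).bddAbove
  · exact ⟨x, hx, rfl⟩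

lemma exists_two {G : Set (E 2)} (h : dimS G = 1) : ∃ c ∈ G, ∃ d ∈ G, c ≠ d := by
  by_contra hcon
  push Not at hcon
  have hs : G.Subsingleton := fun c hc d hd => hcon c hc d hd
  rw [dimS, direction_affineSpan, vectorSpan_of_subsingleton ℝ hs] at h
  simp at h

lemma span_top {P : Set (E 2)} (h : dimS P = 2) : (affineSpan ℝ P).direction = ⊤ := by
  apply Submodule.eq_top_of_finrank_eq
  rw [dimS] at h
  rw [h]; simp

lemma not_const {G : Set (E 2)} (h : (affineSpan ℝ G).direction = ⊤) {u : E 2}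
    (hc : ∀ x ∈ G, ∀ y ∈ G, ⟪u, x⟫ = ⟪u, y⟫) : u = 0 := by
  have : (affineSpan ℝ G).direction ≤ (innerSL ℝ u).toLinearMap.ker := by
    rw [direction_affineSpan, vectorSpan_def, Submodule.span_le]
    rintro _ ⟨x, hx, y, hy, rfl⟩
    simp [inner_sub_right, hc x hx y hy]
  rw [h] at this
  have := this (show u ∈ ⊤ from trivial)
  simpa using this

lemma normal_spec {P G : Set (E 2)} (hP : IsCompact P) (hdim : dimS P = 2)
    (hG : IsFacetOf P G) :
    ‖outerNormal P G‖ = 1 ∧ exposedSet P (outerNormal P G) = G := by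
  have hex : ∃ u : E 2, u ∈ (affineSpan ℝ P).direction ∧ ‖u‖ = 1 ∧ exposedSet P u = G := by
    obtain ⟨hexp, hd⟩ := hG
    have hd1 : dimS G = 1 := by omega
    obtain ⟨c, hc, -⟩ := exists_two hd1
    obtain ⟨l, hl⟩ := hexp ⟨c, hc⟩
    obtain ⟨v, rfl⟩ := (InnerProductSpace.toDual ℝ (E 2)).surjective l
    simp only [InnerProductSpace.toDual_apply_apply] at hl
    have hv : v ≠ 0 := by
      rintro rfl
      simp at hl
      rw [hl] at hd1; omega
    have hn : 0 < ‖v‖ := norm_pos_iff.2 hv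
    refine ⟨‖v‖⁻¹ • v, by rw [span_top hdim]; trivial, ?_, ?_⟩
    · rw [norm_smul, norm_inv, norm_norm, inv_mul_cancel₀ hn.ne']
    · have hc' := hc
      rw [hl] at hc'
      have hs : suppF P (‖v‖⁻¹ • v) = ⟪‖v‖⁻¹ • v, c⟫ := by
        apply le_antisymm _ (le_suppF hP _ hc'.1)
        refine csSup_le (Set.Nonempty.image _ ⟨c, hc'.1⟩) ?_
        rintro _ ⟨y, hy, rfl⟩
        simp only [real_inner_smul_left]
        exact mul_le_mul_of_nonneg_left (hc'.2 y hy) (by positivity)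
      rw [exposedSet, hs, hl]
      ext x
      simp only [mem_ofPred_eq, real_inner_smul_left]
      have hi : ‖v‖⁻¹ ≠ 0 := by positivity
      constructor
      · rintro ⟨hx, h⟩
        refine ⟨hx, ?_⟩
        rw [mul_right_inj' hi] at h
        rw [h]; exact hc'.2
      · rintro ⟨hx, h⟩
        refine ⟨hx, ?_⟩
        rw [le_antisymm (hc'.2 x hx) (h c hc'.1)]
  exact (Classical.epsilon_spec hex).2

lemma endpoint {P G : Set (E 2)} (hP : IsCompact P) (hG : IsExposed ℝ P G) (hne : G.Nonempty)
    {u d : E 2} (hu : u ≠ 0) (hd : d ≠ 0) (hud : ⟪u, d⟫ = 0)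
    (hline : ∀ x ∈ G, ∀ y ∈ G, ⟪u, x⟫ = ⟪u, y⟫) :
    ∃ b ∈ G, b ∈ P.extremePoints ℝ ∧ ∀ y ∈ G, ⟪d, y⟫ ≤ ⟪d, b⟫ := by
  have hGc := hG.isCompact hP
  obtain ⟨b, hb, hmax⟩ := hGc.exists_isMaxOn hne (f := fun y => ⟪d, y⟫) (by fun_prop)
  have hmax' : ∀ y ∈ G, ⟪d, y⟫ ≤ ⟪d, b⟫ := fun y hy => hmax hy
  refine ⟨b, hb, ?_, hmax'⟩
  apply hG.isExtreme.extremePoints_subset_extremePoints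
  refine ⟨hb, fun x hx y hy hxy => ?_⟩
  obtain ⟨α, β, hα, hβ, hs, rfl⟩ := hxy
  have h1 := hmax' x hx
  have h2 := hmax' y hy
  set b := α • x + β • y with hbdef
  have h3 : ⟪d, b⟫ = α * ⟪d, x⟫ + β * ⟪d, y⟫ := by
    rw [hbdef, inner_add_right, inner_smul_right, inner_smul_right]
  have h4 : ⟪d, x⟫ = ⟪d, b⟫ := by
    obtain rfl : β = 1 - α := by linarith
    nlinarith
  obtain ⟨k, hk⟩ := perp_prop hu hd hud (c := x - b)
    (by rw [inner_sub_right, hline x hx b hb, sub_self])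
  have h5 : ⟪d, x - b⟫ = 0 := by rw [inner_sub_right, h4, sub_self]
  rw [hk, inner_smul_right] at h5
  have : k = 0 := (mul_eq_zero.1 h5).resolve_right (by simpa using hd)
  rw [this, zero_smul] at hk
  exact sub_eq_zero.1 hk

lemma conc_pos {f : E 2 → ℝ} (hf : StrictConcaveOn ℝ Set.univ f) {x y z : E 2} (hx : 0 ≤ f x)
    (hy : 0 ≤ f y) (hxy : x ≠ y) (hz : z ∈ openSegment ℝ x y) : 0 < f z := by
  obtain ⟨a, b, ha, hb, hab, rfl⟩ := hz
  have := hf.2 (mem_univ x) (mem_univ y) hxy ha hb hab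
  simp only [smul_eq_mul] at this
  nlinarith [mul_nonneg ha.le hx, mul_nonneg hb.le hy]

/-- Some edge functional is negative at an outside point with nonnegative value. -/
lemma exists_neg_edge {P : Set (E 2)} (hPc : IsCompact P) (hPv : Convex ℝ P) (hdim : dimS P = 2)
    {f : E 2 → ℝ} (hf : StrictConcaveOn ℝ Set.univ f) (hfP : ∀ y ∈ P, 0 ≤ f y)
    (hvan : ∀ v : E 2, IsVertexOf P v → f v = 0) {x : E 2} (hx : x ∉ P) (hfx : 0 ≤ f x) :
    ∃ G, IsFacetOf P G ∧ suppF P (outerNormal P G) < ⟪outerNormal P G, x⟫ := by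
  have hne : P.Nonempty := by
    rw [nonempty_iff_ne_empty]
    rintro rfl
    rw [dimS, direction_affineSpan, vectorSpan_empty] at hdim
    simp at hdim
  have htop : affineSpan ℝ P = ⊤ :=
    (AffineSubspace.direction_eq_top_iff_of_nonempty
      ((affineSpan_nonempty ℝ).2 hne)).1 (span_top hdim)
  have hint : (interior P).Nonempty := hPv.interior_nonempty_iff_affineSpan_eq_top.2 htop
  obtain ⟨w, hw⟩ := hint
  have hwP := interior_subset hw
  obtain ⟨z, hzseg, hzP, hzi⟩ : ∃ z ∈ segment ℝ x w, z ∈ P ∧ z ∉ interior P := by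
    by_contra hcon
    push Not at hcon
    have hpre := (convex_segment (𝕜 := ℝ) x w).isPreconnected
    obtain ⟨t, -, ht1, ht2⟩ := hpre (interior P) Pᶜ isOpen_interior hPc.isClosed.isOpen_compl
      (fun t ht => by
        by_cases h : t ∈ P
        · exact Or.inl (hcon t ht h)
        · exact Or.inr h)
      ⟨w, right_mem_segment ℝ x w, hw⟩ ⟨x, left_mem_segment ℝ x w, hx⟩
    exact ht2 (interior_subset ht1)
  have hxw : x ≠ w := fun h => hx (h ▸ hwP)
  have hzo : z ∈ openSegment ℝ x w := by
    apply mem_openSegment_of_ne_left_right _ _ hzseg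
    · rintro rfl; exact hx hzP
    · rintro rfl; exact hzi hw
  have hfz : 0 < f z := conc_pos hf hfx (hfP w hwP) hxw hzo
  obtain ⟨g, hg⟩ := geometric_hahn_banach_open_point hPv.interior isOpen_interior hzi
  have hgP : ∀ y ∈ P, g y ≤ g z := by
    have hsub : P ⊆ closure (interior P) := by
      rw [hPv.closure_interior_eq_closure_of_nonempty_interior ⟨w, hw⟩]
      exact subset_closure
    intro y hy
    have hcl : IsClosed {y | g y ≤ g z} := isClosed_le (by fun_prop) (by fun_prop)
    exact closure_minimal (fun a ha => (hg a ha).le) hcl (hsub hy)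
  set F : Set (E 2) := {y ∈ P | ∀ y' ∈ P, g y' ≤ g y} with hF
  have hFexp : IsExposed ℝ P F := fun _ => ⟨g, rfl⟩
  have hzF : z ∈ F := ⟨hzP, hgP⟩
  have hFd : IsFacetOf P F := by
    refine ⟨hFexp, ?_⟩
    have hle : dimS F ≤ 2 := by
      have := Submodule.finrank_le (affineSpan ℝ F).direction
      simpa [dimS] using this
    have h2 : dimS F ≠ 2 := by
      intro h2
      obtain ⟨v, rfl⟩ := (InnerProductSpace.toDual ℝ (E 2)).surjective g
      have : v = 0 := by
        apply not_const (span_top h2)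
        intro a ha b hb
        have h1 := ha.2 b hb.1
        have h2 := hb.2 a ha.1
        simp only [InnerProductSpace.toDual_apply_apply] at h1 h2
        exact le_antisymm h2 h1
      have h3 := hg w hw
      simp [this] at h3
    have h0 : dimS F ≠ 0 := by
      intro h0
      rw [dimS, Submodule.finrank_eq_zero, direction_affineSpan, vectorSpan_eq_bot_iff_subsingleton] at h0
      have : F = {z} := h0.eq_singleton_of_mem hzF
      have hv := hvan z (by rw [IsVertexOf, ← this]; exact hFexp)
      linarith
    omega
  refine ⟨F, hFd, ?_⟩
  obtain ⟨hn, hE⟩ := normal_spec hPc hdim hFd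
  set u := outerNormal P F
  have hu : u ≠ 0 := by rintro h; simp [h] at hn
  have hzu : ⟪u, z⟫ = suppF P u := by
    rw [← hE] at hzF; exact hzF.2
  have hwu : ⟪u, w⟫ < suppF P u := by
    obtain ⟨ε, hε, hball⟩ := Metric.isOpen_iff.1 isOpen_interior w hw
    have hmem : w + (ε / 2) • u ∈ P := by
      apply interior_subset
      apply hball
      rw [Metric.mem_ball, dist_eq_norm, add_sub_cancel_left, norm_smul, hn, Real.norm_eq_abs,
        abs_of_pos (by positivity)]
      linarith
    have h1 := le_suppF hPc u hmem
    rw [inner_add_right, inner_smul_right, real_inner_self_eq_norm_sq, hn] at h1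
    linarith
  obtain ⟨a, b, ha, hb, hab, rfl⟩ := hzo
  rw [inner_add_right, inner_smul_right, inner_smul_right] at hzu
  obtain rfl : b = 1 - a := by linarith
  by_contra hcon
  push Not at hcon
  nlinarith [mul_le_mul_of_nonneg_left hcon ha.le, mul_lt_mul_of_pos_left hwu hb]

lemma edge_unique {P : Set (E 2)} (hPc : IsCompact P) (hdim : dimS P = 2)
    {f : E 2 → ℝ} (hf : StrictConcaveOn ℝ Set.univ f) (hfP : ∀ y ∈ P, 0 ≤ f y)
    (hvan : ∀ v ∈ P.extremePoints ℝ, f v = 0) {x : E 2} (hfx : 0 ≤ f x)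
    {G J : Set (E 2)} (hG : IsFacetOf P G) (hJ : IsFacetOf P J)
    (hGx : suppF P (outerNormal P G) < ⟪outerNormal P G, x⟫)
    (hJx : suppF P (outerNormal P J) ≤ ⟪outerNormal P J, x⟫) : G = J := by
  by_contra hGJ
  obtain ⟨hnu, hEu⟩ := normal_spec hPc hdim hG
  obtain ⟨hnv, hEv⟩ := normal_spec hPc hdim hJ
  set u := outerNormal P G
  set v := outerNormal P J
  have hu : u ≠ 0 := by rintro h; simp [h] at hnu
  have hv : v ≠ 0 := by rintro h; simp [h] at hnv
  have mG : ∀ y, y ∈ G ↔ y ∈ P ∧ ⟪u, y⟫ = suppF P u := fun y => by rw [← hEu]; rfl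
  have mJ : ∀ y, y ∈ J ↔ y ∈ P ∧ ⟪v, y⟫ = suppF P v := fun y => by rw [← hEv]; rfl
  -- point of J off the line of G
  obtain ⟨y, hyJ, hyu⟩ : ∃ y ∈ J, ⟪u, y⟫ < suppF P u := by
    by_contra hcon
    push Not at hcon
    have hsub : ∀ y ∈ J, ⟪u, y⟫ = suppF P u := fun y hy =>
      le_antisymm (le_suppF hPc u ((mJ y).1 hy).1) (hcon y hy)
    obtain ⟨c, hc, d, hd, hcd⟩ := exists_two (show dimS J = 1 by have := hJ.2; omega)
    obtain ⟨k, hk⟩ := perp_prop (a := c - d) (b := u) (c := v) (sub_ne_zero.2 hcd) hu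
      (by rw [real_inner_comm, inner_sub_right, hsub c hc, hsub d hd, sub_self])
      (by rw [real_inner_comm, inner_sub_right, ((mJ c).1 hc).2, ((mJ d).1 hd).2, sub_self])
    apply hGJ
    ext s
    constructor
    · intro hs
      rw [mG] at hs
      rw [mJ]
      refine ⟨hs.1, ?_⟩
      rw [← ((mJ c).1 hc).2, hk, real_inner_smul_left, real_inner_smul_left, hs.2, hsub c hc]
    · intro hs
      exact (mG s).2 ⟨((mJ s).1 hs).1, hsub s hs⟩
  have hyP := ((mJ y).1 hyJ).1
  have hyv := ((mJ y).1 hyJ).2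
  -- the crossing point
  have hxy : x ≠ y := by rintro rfl; linarith
  obtain ⟨z, hzo, hzu, hzv⟩ : ∃ z ∈ openSegment ℝ x y, ⟪u, z⟫ = suppF P u ∧ suppF P v ≤ ⟪v, z⟫ := by
    set A := ⟪u, x⟫ - suppF P u
    set B := suppF P u - ⟪u, y⟫
    have hA : 0 < A := sub_pos.2 hGx
    have hB : 0 < B := sub_pos.2 hyu
    refine ⟨(B / (A + B)) • x + (A / (A + B)) • y,
      ⟨_, _, by positivity, by positivity, by field_simp; ring, rfl⟩, ?_, ?_⟩
    · rw [inner_add_right, inner_smul_right, inner_smul_right,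
        show ⟪u, x⟫ = suppF P u + A by simp [A], show ⟪u, y⟫ = suppF P u - B by simp [B]]
      field_simp
      ring
    · rw [inner_add_right, inner_smul_right, inner_smul_right, hyv]
      have h1 : A / (A + B) = 1 - B / (A + B) := by field_simp; ring
      have h2 : 0 ≤ B / (A + B) := by positivity
      rw [h1]
      nlinarith [mul_le_mul_of_nonneg_left hJx h2]
  have hfz : 0 < f z := conc_pos hf hfx (hfP y hyP) hxy hzo
  -- endpoints
  obtain ⟨c, hc, c', hc', hcc⟩ := exists_two (show dimS G = 1 by have := hG.2; omega)
  have hline : ∀ x ∈ G, ∀ y ∈ G, ⟪u, x⟫ = ⟪u, y⟫ := fun x hx y hy => by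
    rw [((mG x).1 hx).2, ((mG y).1 hy).2]
  set d := c - c'
  have hd : d ≠ 0 := sub_ne_zero.2 hcc
  have hud : ⟪u, d⟫ = 0 := by rw [inner_sub_right, hline c hc c' hc', sub_self]
  obtain ⟨b, hb, hbe, hbm⟩ := endpoint hPc hG.1 ⟨c, hc⟩ hu hd hud hline
  obtain ⟨a, ha, hae, ham⟩ := endpoint hPc hG.1 ⟨c, hc⟩ hu (neg_ne_zero.2 hd)
    (by rw [inner_neg_right, hud, neg_zero]) hline
  simp only [inner_neg_left, neg_le_neg_iff] at ham
  have hdd : 0 < ⟪d, d⟫ := real_inner_self_pos.2 hd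
  have hab : ⟪d, a⟫ < ⟪d, b⟫ := by
    have h1 := hbm c hc
    have h2 := ham c' hc'
    have h3 : ⟪d, d⟫ = ⟪d, c⟫ - ⟪d, c'⟫ := by rw [← inner_sub_right]
    linarith
  obtain ⟨β, hβ⟩ := perp_prop hu hd hud (c := b - a)
    (by rw [inner_sub_right, hline b hb a ha, sub_self])
  have hβ0 : 0 < β := by
    have h1 : ⟪d, b - a⟫ = β * ⟪d, d⟫ := by rw [hβ, inner_smul_right]
    rw [inner_sub_right] at h1
    by_contra hcon
    push Not at hcon
    nlinarith
  have hba : b ≠ a := by rintro rfl; exact lt_irrefl _ hab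
  obtain ⟨t, ht⟩ := perp_prop hu (sub_ne_zero.2 hba)
    (by rw [inner_sub_right, hline b hb a ha, sub_self]) (c := z - a)
    (by rw [inner_sub_right, hzu, ((mG a).1 ha).2, sub_self])
  have hz : z = a + t • (b - a) := by rw [← ht]; abel
  have hfa := hvan a hae
  have hfb := hvan b hbe
  have hza : z ≠ a := by rintro rfl; linarith
  have hzb : z ≠ b := by rintro rfl; linarith
  have ht0 : 0 < t := by
    by_contra hcon
    push Not at hcon
    have : 0 < f a := by
      refine conc_pos hf hfz.le hfb.ge hzb ?_
      have hne : t ≠ 0 := by rintro rfl; simp at hz; exact hza hz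
      have hlt : t < 0 := lt_of_le_of_ne hcon hne
      have h1 : 0 < 1 - t := by linarith
      refine ⟨1 / (1 - t), -t / (1 - t), by positivity, div_pos (by linarith) h1,
        by field_simp; ring, ?_⟩
      rw [hz]
      match_scalars <;> field_simp <;> ring
    linarith
  have ht1 : t < 1 := by
    by_contra hcon
    push Not at hcon
    have : 0 < f b := by
      refine conc_pos hf hfz.le hfa.ge hza ?_
      have hne : t ≠ 1 := by rintro rfl; simp at hz; exact hzb hz
      have hlt : 1 < t := lt_of_le_of_ne hcon hne.symm
      refine ⟨1 / t, (t - 1) / t, by positivity, div_pos (by linarith) ht0,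
        by field_simp; ring, ?_⟩
      rw [hz]
      match_scalars <;> field_simp <;> ring
    linarith
  have hav := le_suppF hPc v ((mG a).1 ha).1
  have hbv := le_suppF hPc v ((mG b).1 hb).1
  rw [hz, inner_add_right, inner_smul_right, inner_sub_right] at hzv
  have hav' : ⟪v, a⟫ = suppF P v := by nlinarith
  have hbv' : ⟪v, b⟫ = suppF P v := by nlinarith
  obtain ⟨k, hk⟩ := perp_prop (a := b - a) (b := v) (c := u) (sub_ne_zero.2 hba) hv
    (by rw [real_inner_comm, inner_sub_right, hav', hbv', sub_self])
    (by rw [real_inner_comm, inner_sub_right, hline b hb a ha, sub_self])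
  have h1 : ⟪u, y⟫ = ⟪u, a⟫ := by
    rw [hk, real_inner_smul_left, real_inner_smul_left, hyv, hav']
  rw [((mG a).1 ha).2] at h1
  linarith

/-- A convex polygon P in ℝ² is described by a strictly concave polynomial
vanishing at the vertices together with the product of the edge functionals q_I(P,·). -/
theorem polygon_two_polynomials
    (P : Set (E 2)) (hP : IsPolytope P) (hdim : dimS P = 2)
    (p₀ p₁ : MvPolynomial (Fin 2) ℝ)
    (hconc : StrictConcaveOn ℝ Set.univ (evalPoly p₀))
    (hvan : ∀ v : E 2, IsVertexOf P v → evalPoly p₀ v = 0)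
    (m : ℕ) (I : Fin m → Set (E 2)) (hinj : Function.Injective I)
    (hedge : ∀ i, IsFacetOf P (I i)) (hall : ∀ G, IsFacetOf P G → ∃ i, I i = G)
    (hp₁ : ∀ x : E 2, evalPoly p₁ x = ∏ i, qF P (I i) x) :
    P = {x : E 2 | 0 ≤ evalPoly p₀ x ∧ 0 ≤ evalPoly p₁ x} := by
  obtain ⟨V, hV, hVv⟩ := exists_vertices hP
  have hPc : IsCompact P := by rw [hV]; exact V.finite_toSet.isCompact_convexHull ℝ
  have hPv : Convex ℝ P := by rw [hV]; exact convex_convexHull ℝ _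
  have hext : ∀ v ∈ P.extremePoints ℝ, evalPoly p₀ v = 0 := by
    intro v hv
    rw [hV] at hv
    exact hvan v (hVv v (extremePoints_convexHull_subset hv))
  have hfP : ∀ y ∈ P, 0 ≤ evalPoly p₀ y := by
    intro y hy
    have hcv : Convex ℝ {y | y ∈ Set.univ ∧ 0 ≤ evalPoly p₀ y} := hconc.concaveOn.convex_ge 0
    have hsub : P ⊆ {y | y ∈ Set.univ ∧ 0 ≤ evalPoly p₀ y} := by
      rw [hV]
      exact convexHull_min (fun v hv => ⟨trivial, (hvan v (hVv v hv)).ge⟩) hcv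
    exact (hsub hy).2
  ext x
  constructor
  · intro hx
    refine ⟨hfP x hx, ?_⟩
    rw [hp₁]
    apply Finset.prod_nonneg
    intro i _
    exact div_nonneg (sub_nonneg.2 (le_suppF hPc _ hx)) Metric.diam_nonneg
  · rintro ⟨h0, h1⟩
    by_contra hx
    obtain ⟨G, hG, hGx⟩ := exists_neg_edge hPc hPv hdim hconc hfP hvan hx h0
    obtain ⟨i₀, rfl⟩ := hall G hG
    have hdiam : 0 < Metric.diam P := by
      obtain ⟨c, hc, d, hd, hcd⟩ := exists_two (show dimS (I i₀) = 1 by have := hG.2; omega)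
      have := Metric.dist_le_diam_of_mem hPc.isBounded (hG.1.subset hc) (hG.1.subset hd)
      exact lt_of_lt_of_le (dist_pos.2 hcd) this
    have hneg : qF P (I i₀) x < 0 := div_neg_of_neg_of_pos (by linarith) hdiam
    have hpos : 0 < ∏ i ∈ Finset.univ.erase i₀, qF P (I i) x := by
      apply Finset.prod_pos
      intro i hi
      apply div_pos _ hdiam
      by_contra hcon
      push Not at hcon
      have := edge_unique hPc hdim hconc hfP hext h0 hG (hedge i) hGx (by linarith)
      exact (Finset.mem_erase.1 hi).1 (hinj this).symm
    rw [hp₁, ← Finset.mul_prod_erase _ _ (Finset.mem_univ i₀)] at h1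
    nlinarith [mul_neg_of_neg_of_pos hneg hpos]
end
end
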